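/- arXiv:0705.3270 — 6 statements merged into one kernel-verified Lean document; each statement's English description precedes it below -/
import Mathlib

section
/- Let (R,T) be a CEER (compact étale equivalence relation) on a compact, metrizable, zero-dimensional space X, and give X × X the product topology. Then: (i) T equals the relative topology that R inherits from X × X; (ii) R is a closed subset of X × X and the quotient space X/R with the quotient topology is Hausdorff; (iii) R is uniformly finite, i.e. there is a natural number N such that the number of elements of the R-equivalence class [x]_R is at most N for every x ∈ X. -/
open Set Topology MeasureTheory

universe u v

/-! ### Basic notions: étale equivalence relations -/

/-- The set of composable pairs of an equivalence relation `R ⊆ X × X`. -/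
def CompPairs {X : Type u} (R : Set (X × X)) : Set (↥R × ↥R) :=
  {q | (q.1 : X × X).2 = (q.2 : X × X).1}

/-- The topology on the set of composable pairs obtained from a topology `T` on `R`. -/
def compPairsTop {X : Type u} (R : Set (X × X)) (T : TopologicalSpace ↥R) :
    TopologicalSpace ↥(CompPairs R) :=
  letI := T; inferInstance

/-- The composition (product) map of the groupoid `R`. -/
def compMap {X : Type u} (R : Set (X × X))
    (htrans : ∀ ⦃x y z : X⦄, (x, y) ∈ R → (y, z) ∈ R → (x, z) ∈ R) :
    ↥(CompPairs R) → ↥R := fun q =>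
  ⟨((q.1.1 : X × X).1, (q.1.2 : X × X).2),
    htrans q.1.1.2 (by
      rw [show ((q.1.1 : X × X)).2 = ((q.1.2 : X × X)).1 from q.2]
      exact q.1.2.2)⟩

/-- The inverse map of the groupoid `R`. -/
def invMap {X : Type u} (R : Set (X × X))
    (hsymm : ∀ ⦃x y : X⦄, (x, y) ∈ R → (y, x) ∈ R) : ↥R → ↥R := fun p =>
  ⟨((p : X × X).2, (p : X × X).1), hsymm p.2⟩

/-- `(R, T)` is an étale equivalence relation on `X`: a countable equivalence relation
equipped with a Hausdorff, locally compact, second countable topology `T` such that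
composition of composable pairs is continuous, inversion is a homeomorphism, and the
range map `r(x,y) = x` is a local homeomorphism. -/
structure IsEtaleEquivRel {X : Type u} [TopologicalSpace X] (R : Set (X × X))
    (T : TopologicalSpace ↥R) : Prop where
  refl : ∀ x : X, (x, x) ∈ R
  symm : ∀ ⦃x y : X⦄, (x, y) ∈ R → (y, x) ∈ R
  trans : ∀ ⦃x y z : X⦄, (x, y) ∈ R → (y, z) ∈ R → (x, z) ∈ R
  countable : ∀ x : X, {y | (x, y) ∈ R}.Countable
  t2 : @T2Space ↥R T
  locallyCompact : @LocallyCompactSpace ↥R T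
  secondCountable : @SecondCountableTopology ↥R T
  continuous_comp : @Continuous _ _ (compPairsTop R T) T (compMap R trans)
  homeo_inv : @IsHomeomorph _ _ T T (invMap R symm)
  localHomeo_range : @IsLocalHomeomorph ↥R X T inferInstance fun p => (p : X × X).1

/-- A CEER: compact étale equivalence relation. -/
def IsCEER {X : Type u} [TopologicalSpace X] (R : Set (X × X))
    (T : TopologicalSpace ↥R) : Prop :=
  IsEtaleEquivRel R T ∧ @CompactSpace ↥R T

/-- `R ⊆ X × X` is an equivalence relation. -/
def IsEquivRel {X : Type u} (R : Set (X × X)) : Prop :=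
  (∀ x : X, (x, x) ∈ R) ∧ (∀ ⦃x y : X⦄, (x, y) ∈ R → (y, x) ∈ R) ∧
    (∀ ⦃x y z : X⦄, (x, y) ∈ R → (y, z) ∈ R → (x, z) ∈ R)

/-- The relative topology on `R ⊆ X × X` inherited from the product topology. -/
def relTop {X : Type u} [TopologicalSpace X] (R : Set (X × X)) : TopologicalSpace ↥R :=
  inferInstance

/-- Given a topology `T` on `R` and any `U ⊆ X × X` (intended: `U ⊆ R`), the relative
topology on `U` induced from `(R, T)`. -/
def relSubTop {X : Type u} [TopologicalSpace X] {R : Set (X × X)}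
    (T : TopologicalSpace ↥R) (U : Set (X × X)) : TopologicalSpace ↥U :=
  TopologicalSpace.induced Subtype.val
    (TopologicalSpace.coinduced (Subtype.val : ↥R → X × X) T)

/-- An equivalence relation is minimal if all equivalence classes are dense. -/
def IsMinimalRel {X : Type u} [TopologicalSpace X] (R : Set (X × X)) : Prop :=
  ∀ x : X, Dense {y | (x, y) ∈ R}

/-- `F` implements an isomorphism between the étale equivalence relations
`(R₁, T₁)` on `X` and `(R₂, T₂)` on `Z`. -/
def ImplementsIso {X : Type u} {Z : Type v} [TopologicalSpace X] [TopologicalSpace Z]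
    (R₁ : Set (X × X)) (T₁ : TopologicalSpace ↥R₁)
    (R₂ : Set (Z × Z)) (T₂ : TopologicalSpace ↥R₂) (F : X → Z) : Prop :=
  IsHomeomorph F ∧ (∀ x y : X, (x, y) ∈ R₁ ↔ (F x, F y) ∈ R₂) ∧
    ∃ G : ↥R₁ → ↥R₂, (∀ p : ↥R₁, (G p : Z × Z) = (F (p : X × X).1, F (p : X × X).2)) ∧
      @IsHomeomorph _ _ T₁ T₂ G

/-! ### Graphs, invariant measures, thin sets -/

/-- A (local) graph in `(R, T)`: a clopen subset on which both the range and source maps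
are homeomorphisms onto clopen subsets of `X`. -/
def IsGraph {X : Type u} [TopologicalSpace X] (R : Set (X × X))
    (T : TopologicalSpace ↥R) (U : Set ↥R) : Prop :=
  letI := T
  IsClopen U ∧
    IsClopen ((fun p : ↥R => (p : X × X).1) '' U) ∧
    IsClopen ((fun p : ↥R => (p : X × X).2) '' U) ∧
    Topology.IsEmbedding (fun p : ↥U => ((p : ↥R) : X × X).1) ∧
    Topology.IsEmbedding (fun p : ↥U => ((p : ↥R) : X × X).2)

/-- A probability measure is `R`-invariant when `μ(A) = μ(B)` for every graph `(A, γ, B)`. -/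
def IsInvariantMeasure {X : Type u} [TopologicalSpace X] [MeasurableSpace X]
    (R : Set (X × X)) (T : TopologicalSpace ↥R) (μ : Measure X) : Prop :=
  ∀ U : Set ↥R, IsGraph R T U →
    μ ((fun p : ↥R => (p : X × X).1) '' U) = μ ((fun p : ↥R => (p : X × X).2) '' U)

/-- `Y` is `R`-thin: `μ Y = 0` for every `R`-invariant probability measure `μ`. -/
def IsThin {X : Type u} [TopologicalSpace X] [MeasurableSpace X]
    (R : Set (X × X)) (T : TopologicalSpace ↥R) (Y : Set X) : Prop :=
  ∀ μ : Measure X, IsProbabilityMeasure μ → IsInvariantMeasure R T μ → μ Y = 0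

/-! ### AF-equivalence relations -/

/-- The inductive limit topology on `R = ⋃ n, Rseq n`, each `Rseq n` carrying its
relative topology from `X × X`. -/
def inductiveLimitTop {X : Type u} [TopologicalSpace X] (R : Set (X × X))
    (Rseq : ℕ → Set (X × X)) (hsub : ∀ n, Rseq n ⊆ R) : TopologicalSpace ↥R :=
  ⨆ n, TopologicalSpace.coinduced
    (fun p : ↥(Rseq n) => (⟨(p : X × X), hsub n p.2⟩ : ↥R)) (relTop (Rseq n))

/-- `(R, T)` is an AF-equivalence relation: the inductive limit of an ascending sequence
of CEERs `Δ_X = R₀ ⊆ R₁ ⊆ R₂ ⊆ ⋯` with each `Rₙ` open in `Rₙ₊₁`, `T` being the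
inductive limit topology. -/
def IsAFEquivRel {X : Type u} [TopologicalSpace X] (R : Set (X × X))
    (T : TopologicalSpace ↥R) : Prop :=
  ∃ (Rseq : ℕ → Set (X × X)) (hsub : ∀ n, Rseq n ⊆ R),
    Rseq 0 = Set.diagonal X ∧
    (∀ n, Rseq n ⊆ Rseq (n + 1)) ∧
    (∀ n, IsCEER (Rseq n) (relTop (Rseq n))) ∧
    (∀ n, IsOpen[relTop (Rseq (n + 1))]
      ((Subtype.val : ↥(Rseq (n + 1)) → X × X) ⁻¹' Rseq n)) ∧
    (⋃ n, Rseq n) = R ∧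
    T = inductiveLimitTop R Rseq hsub

/-! ### Clopen partitions and groupoid partitions -/

/-- `U · V` for subsets `U, V ⊆ X × X`. -/
def SetComp {X : Type u} (U V : Set (X × X)) : Set (X × X) :=
  {p | ∃ y : X, (p.1, y) ∈ U ∧ (y, p.2) ∈ V}

/-- `U⁻¹` for a subset `U ⊆ X × X`. -/
def SetInv {X : Type u} (U : Set (X × X)) : Set (X × X) :=
  {p | (p.2, p.1) ∈ U}

/-- `P` is finer than `Q` if every element of `P` is contained in some element of `Q`. -/
def FinerThan {α : Type u} (P Q : Set (Set α)) : Prop :=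
  ∀ U ∈ P, ∃ V ∈ Q, U ⊆ V

/-- A finite clopen partition of `(R, T)` by subsets of `X × X`. -/
def IsClopenPartitionRel {X : Type u} [TopologicalSpace X] (R : Set (X × X))
    (T : TopologicalSpace ↥R) (P : Set (Set (X × X))) : Prop :=
  letI := T
  P.Finite ∧ (∀ U ∈ P, U ⊆ R ∧ U.Nonempty ∧ IsClopen ((Subtype.val : ↥R → X × X) ⁻¹' U)) ∧
    P.PairwiseDisjoint id ∧ ⋃₀ P = R

/-- A finite clopen partition of a topological space `Z`. -/
def IsClopenPartitionSpace (Z : Type u) [TopologicalSpace Z] (P : Set (Set Z)) : Prop :=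
  P.Finite ∧ (∀ U ∈ P, U.Nonempty ∧ IsClopen U) ∧ P.PairwiseDisjoint id ∧ ⋃₀ P = Set.univ

/-- A groupoid partition of the CEER `(R, T)`. -/
def IsGroupoidPartition {X : Type u} [TopologicalSpace X] (R : Set (X × X))
    (T : TopologicalSpace ↥R) (P : Set (Set (X × X))) : Prop :=
  IsClopenPartitionRel R T P ∧
    (∀ U ∈ P, U ⊆ Set.diagonal X ∨ U ⊆ R \ Set.diagonal X) ∧
    (∀ U ∈ P,
      @Topology.IsEmbedding ↥U X (relSubTop T U) _ (fun p => (p : X × X).1) ∧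
      @Topology.IsEmbedding ↥U X (relSubTop T U) _ (fun p => (p : X × X).2)) ∧
    (∀ U ∈ P, U ⊆ R \ Set.diagonal X → (Prod.fst '' U) ∩ (Prod.snd '' U) = ∅) ∧
    (∀ U ∈ P, ∀ V ∈ P, SetComp U V = ∅ ∨ SetComp U V ∈ P) ∧
    (∀ U ∈ P, SetInv U ∈ P)

/-- The trace on the diagonal of a partition of `R`, viewed as a family of subsets of `X`. -/
def diagTrace {X : Type u} (P : Set (Set (X × X))) : Set (Set X) :=
  {A | ∃ U ∈ P, U ⊆ Set.diagonal X ∧ A = Prod.fst '' U}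

/-! ### Restriction to a closed subset -/

/-- The restriction `R|_Y` of `R ⊆ X × X` to `Y ⊆ X`, as a relation on `↥Y`. -/
def restrictRel {X : Type u} (R : Set (X × X)) (Y : Set X) : Set (↥Y × ↥Y) :=
  {p | ((p.1 : X), (p.2 : X)) ∈ R}

/-- The relative topology on `R|_Y` induced from `(R, T)`. -/
def restrictTop {X : Type u} [TopologicalSpace X] (R : Set (X × X))
    (T : TopologicalSpace ↥R) (Y : Set X) : TopologicalSpace ↥(restrictRel R Y) :=
  TopologicalSpace.induced
    (fun p : ↥(restrictRel R Y) => (⟨((p.1.1 : X), (p.1.2 : X)), p.2⟩ : ↥R)) T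

/-! ### Fibred products, transversality, joins -/

/-- The fibred product `R ×_X S`. -/
abbrev Fib {X : Type u} (R S : Set (X × X)) : Type u :=
  {q : ↥R × ↥S // (q.1 : X × X).2 = (q.2 : X × X).1}

/-- The range map `r((x,y),(y,z)) = x` on `R ×_X S`. -/
def fibR {X : Type u} {R S : Set (X × X)} (q : Fib R S) : X := (q.1.1 : X × X).1

/-- The source map `s((x,y),(y,z)) = z` on `R ×_X S`. -/
def fibS {X : Type u} {R S : Set (X × X)} (q : Fib R S) : X := (q.1.2 : X × X).2

/-- The relative topology on `R ×_X S` from the product of `(R, T)` and `(S, T')`. -/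
def fibTop {X : Type u} {R S : Set (X × X)} (T : TopologicalSpace ↥R)
    (T' : TopologicalSpace ↥S) : TopologicalSpace (Fib R S) :=
  letI := T; letI := T'; inferInstance

/-- `(R, T)` and `(S, T')` are transverse: `R ∩ S = Δ_X` and there is a homeomorphism
`h : R ×_X S → S ×_X R` with `r ∘ h = r` and `s ∘ h = s`. -/
def AreTransverse {X : Type u} [TopologicalSpace X] (R : Set (X × X))
    (T : TopologicalSpace ↥R) (S : Set (X × X)) (T' : TopologicalSpace ↥S) : Prop :=
  R ∩ S = Set.diagonal X ∧
    ∃ h : Fib R S → Fib S R,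
      @IsHomeomorph _ _ (fibTop T T') (fibTop T' T) h ∧
      (∀ q, fibR (h q) = fibR q) ∧ (∀ q, fibS (h q) = fibS q)

/-- The equivalence relation `R ∨ S` generated by `R` and `S`. -/
def joinRel {X : Type u} (R S : Set (X × X)) : Set (X × X) :=
  {p | Relation.EqvGen (fun a b => (a, b) ∈ R ∨ (a, b) ∈ S) p.1 p.2}

/-- The map `r × s : R ×_X S → R ∨ S`. -/
def rsFun {X : Type u} (R S : Set (X × X)) : Fib R S → ↥(joinRel R S) := fun q =>
  ⟨(fibR q, fibS q), by
    have h1 : ((q.1.1 : X × X).1, (q.1.1 : X × X).2) ∈ R := q.1.1.2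
    have h2 : ((q.1.1 : X × X).2, (q.1.2 : X × X).2) ∈ S := by
      rw [show ((q.1.1 : X × X)).2 = ((q.1.2 : X × X)).1 from q.2]
      exact q.1.2.2
    exact Relation.EqvGen.trans _ _ _ (Relation.EqvGen.rel _ _ (Or.inl h1))
      (Relation.EqvGen.rel _ _ (Or.inr h2))⟩

/-- The topology on `R ∨ S` transferred from `R ×_X S` via the bijection `r × s`. -/
def joinTop {X : Type u} [TopologicalSpace X] (R S : Set (X × X))
    (T : TopologicalSpace ↥R) (T' : TopologicalSpace ↥S) :
    TopologicalSpace ↥(joinRel R S) :=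
  TopologicalSpace.coinduced (rsFun R S) (fibTop T T')

/-- The topology on an image `f '' s` transferred from a topology on `s` via `f`. -/
def imageTop {α : Type u} {β : Type v} (s : Set α) (Ts : TopologicalSpace ↥s)
    (f : α → β) : TopologicalSpace ↥(f '' s) :=
  TopologicalSpace.coinduced (fun p : ↥s => ⟨f p.1, ⟨p.1, p.2, rfl⟩⟩) Ts
/-! ### Bratteli diagrams -/

/-- A (standard) Bratteli diagram. `V n` is the (finite, nonempty) vertex set at level `n`
(`V 0` a singleton), and `E n` is the edge set connecting level `n` to level `n + 1`
(so `E n` plays the role of `E_{n+1}` in the paper), with source map `src n : E n → V n`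
and range map `rng n : E n → V (n+1)`, both surjective. -/
structure BratteliDiagram : Type 1 where
  V : ℕ → Type
  E : ℕ → Type
  fin_V : ∀ n, Finite (V n)
  fin_E : ∀ n, Finite (E n)
  nonempty_V : ∀ n, Nonempty (V n)
  nonempty_E : ∀ n, Nonempty (E n)
  subsingleton_V0 : Subsingleton (V 0)
  src : ∀ n, E n → V n
  rng : ∀ n, E n → V (n + 1)
  src_surj : ∀ n, Function.Surjective (src n)
  rng_surj : ∀ n, Function.Surjective (rng n)

namespace BratteliDiagram

/-- The path space `X_{(V,E)}` of a Bratteli diagram. -/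
abbrev pathSpace (B : BratteliDiagram) : Type :=
  {x : ∀ n, B.E n // ∀ n, B.rng n (x n) = B.src (n + 1) (x (n + 1))}

/-- The topology on the path space: the relative topology from `∏ n, E n`
with each `E n` discrete. -/
def pathTop (B : BratteliDiagram) : TopologicalSpace B.pathSpace :=
  letI : ∀ n, TopologicalSpace (B.E n) := fun _ => ⊥
  inferInstance

/-- `AF_n(V,E)`: cofinality from level `n` on. -/
def AFn (B : BratteliDiagram) (n : ℕ) : Set (B.pathSpace × B.pathSpace) :=
  {p | ∀ m, n ≤ m → p.1.1 m = p.2.1 m}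

/-- The relative topology on `AF_n(V,E)` from `X_{(V,E)} × X_{(V,E)}`. -/
def AFnTop (B : BratteliDiagram) (n : ℕ) : TopologicalSpace ↥(B.AFn n) :=
  letI := B.pathTop
  inferInstance

/-- The cofinality relation `AF(V,E) = ⋃ n, AF_n(V,E)`. -/
def AF (B : BratteliDiagram) : Set (B.pathSpace × B.pathSpace) :=
  ⋃ n, B.AFn n

/-- The inductive limit topology on `AF(V,E)`. -/
def AFTop (B : BratteliDiagram) : TopologicalSpace ↥B.AF :=
  ⨆ n, TopologicalSpace.coinduced
    (fun p : ↥(B.AFn n) => (⟨p.1, Set.mem_iUnion.mpr ⟨n, p.2⟩⟩ : ↥B.AF)) (B.AFnTop n)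

/-- A Bratteli diagram is simple if for every level `n` there is a later level such that
every vertex at level `n` is connected by a path of edges to every vertex at that level. -/
def IsSimple (B : BratteliDiagram) : Prop :=
  ∀ n : ℕ, ∃ k : ℕ, ∀ (v : B.V n) (w : B.V (n + k + 1)),
    ∃ es : ∀ j, B.E j, B.src n (es n) = v ∧ B.rng (n + k) (es (n + k)) = w ∧
      ∀ j, n ≤ j → j + 1 ≤ n + k → B.rng j (es j) = B.src (j + 1) (es (j + 1))

end BratteliDiagram

/-- `Fs` determines an (edge) Bratteli subdiagram of `B`. -/
def IsSubdiagram (B : BratteliDiagram) (Fs : ∀ n, Set (B.E n)) : Prop :=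
  (∀ n, (Fs n).Nonempty) ∧ ∀ n, B.src (n + 1) '' Fs (n + 1) = B.rng n '' Fs n

/-- Vertex sets of the subdiagram determined by `Fs`. -/
def subVertex (B : BratteliDiagram) (Fs : ∀ n, Set (B.E n)) : ℕ → Type
  | 0 => B.V 0
  | n + 1 => ↥(B.rng n '' Fs n)

/-- The Bratteli subdiagram of `B` determined by `Fs`, as a Bratteli diagram. -/
def subdiagramB (B : BratteliDiagram) (Fs : ∀ n, Set (B.E n))
    (h : IsSubdiagram B Fs) : BratteliDiagram where
  V := subVertex B Fs
  E n := ↥(Fs n)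
  fin_V n := by
    cases n with
    | zero => exact B.fin_V 0
    | succ m => haveI := B.fin_V (m + 1); exact inferInstanceAs (Finite ↥(B.rng m '' Fs m))
  fin_E n := by haveI := B.fin_E n; exact inferInstanceAs (Finite ↥(Fs n))
  nonempty_V n := by
    cases n with
    | zero => exact B.nonempty_V 0
    | succ m =>
      obtain ⟨e, he⟩ := h.1 m
      exact ⟨⟨B.rng m e, ⟨e, he, rfl⟩⟩⟩
  nonempty_E n := by obtain ⟨e, he⟩ := h.1 n; exact ⟨⟨e, he⟩⟩
  subsingleton_V0 := B.subsingleton_V0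
  src n := match n with
    | 0 => fun e => B.src 0 e.1
    | m + 1 => fun e =>
      ⟨B.src (m + 1) e.1, by rw [← h.2 m]; exact ⟨e.1, e.2, rfl⟩⟩
  rng n := fun e => ⟨B.rng n e.1, ⟨e.1, e.2, rfl⟩⟩
  src_surj n := by
    cases n with
    | zero =>
      intro v
      haveI : Subsingleton (subVertex B Fs 0) := B.subsingleton_V0
      obtain ⟨e, he⟩ := h.1 0
      exact ⟨⟨e, he⟩, Subsingleton.elim _ _⟩
    | succ m =>
      intro v
      obtain ⟨vv, hvv⟩ := v
      rw [← h.2 m] at hvv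
      obtain ⟨e, he, hev⟩ := hvv
      exact ⟨⟨e, he⟩, Subtype.ext hev⟩
  rng_surj n := by
    intro v
    obtain ⟨vv, hv⟩ := v
    obtain ⟨e, he, hev⟩ := hv
    exact ⟨⟨e, he⟩, Subtype.ext hev⟩

/-! ### Orbit equivalence relation of a group action -/

/-- The orbit equivalence relation `R_G = {(x, g•x)}` of a group action. -/
def orbitRelSet (G : Type v) (X : Type u) [Group G] [MulAction G X] : Set (X × X) :=
  {p | ∃ g : G, p.2 = g • p.1}

/-- The topology on `R_G` transferred from the product topology on `X × G`
(`G` discrete) via the bijection `(x, g) ↦ (x, g • x)`. -/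
def orbitRelTop (G : Type v) (X : Type u) [TopologicalSpace X] [Group G] [MulAction G X] :
    TopologicalSpace ↥(orbitRelSet G X) :=
  letI : TopologicalSpace G := ⊥
  TopologicalSpace.coinduced
    (fun q : X × G => (⟨(q.1, q.2 • q.1), ⟨q.2, rfl⟩⟩ : ↥(orbitRelSet G X))) inferInstance

/-- Let `(R, T)` be a CEER on a compact, metrizable, zero-dimensional
space `X`. Then (i) `T` is the relative topology from `X × X`; (ii) `R` is closed in
`X × X` and the quotient `X/R` is Hausdorff; (iii) `R` is uniformly finite. -/
theorem ceer_structure {X : Type} [TopologicalSpace X] [CompactSpace X]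
    [TopologicalSpace.MetrizableSpace X] [TotallyDisconnectedSpace X]
    (R : Set (X × X)) (T : TopologicalSpace ↥R) (h : IsCEER R T) :
    T = relTop R ∧
    (IsClosed R ∧ T2Space (Quot fun x y : X => (x, y) ∈ R)) ∧
    ∃ N : ℕ, ∀ x : X, {y | (x, y) ∈ R}.Finite ∧ {y | (x, y) ∈ R}.ncard ≤ N := by
  obtain ⟨he, hc⟩ := h
  letI : TopologicalSpace ↥R := T
  haveI : CompactSpace ↥R := hc
  haveI : T2Space ↥R := he.t2
  have hr : IsLocalHomeomorph (fun p : ↥R => (p : X × X).1) := he.localHomeo_range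
  have hs : Continuous (fun p : ↥R => (p : X × X).2) :=
    hr.continuous.comp he.homeo_inv.continuous
  have hv : Continuous (fun p : ↥R => (p : X × X)) := hr.continuous.prodMk hs
  have hemb : Topology.IsClosedEmbedding (fun p : ↥R => (p : X × X)) :=
    hv.isClosedEmbedding Subtype.val_injective
  have hclosed : IsClosed R := by
    have := hemb.isClosed_range
    rwa [Subtype.range_coe] at this
  refine ⟨hemb.eq_induced, ⟨hclosed, ?_⟩, ?_⟩
  · have heqv : Equivalence (fun x y : X => (x, y) ∈ R) :=
      ⟨he.refl, fun h => he.symm h, fun h1 h2 => he.trans h1 h2⟩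
    have hq : IsOpenQuotientMap (Quot.mk (fun x y : X => (x, y) ∈ R)) := by
      refine ⟨Quot.mk_surjective, continuous_quot_mk, ?_⟩
      intro U hU
      change IsOpen (Quot.mk _ ⁻¹' _)
      have : (Quot.mk (fun x y : X => (x, y) ∈ R)) ⁻¹' (Quot.mk _ '' U) =
          (fun p : ↥R => (p : X × X).1) '' ((fun p : ↥R => (p : X × X).2) ⁻¹' U) := by
        ext x
        constructor
        · rintro ⟨y, hy, hxy⟩
          have h1 : (y, x) ∈ R := (heqv.quot_mk_eq_iff y x).1 hxy
          exact ⟨⟨(x, y), he.symm h1⟩, hy, rfl⟩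
        · rintro ⟨⟨⟨a, b⟩, hab⟩, hb, rfl⟩
          exact ⟨b, hb, Quot.sound (he.symm hab)⟩
      rw [this]
      exact hr.isOpenMap _ (hU.preimage hs)
    rw [t2Space_iff_of_isOpenQuotientMap hq]
    have : {q : X × X | Quot.mk (fun x y : X => (x, y) ∈ R) q.1 = Quot.mk _ q.2} = R := by
      ext ⟨a, b⟩
      exact heqv.quot_mk_eq_iff a b
    rw [this]
    exact hclosed
  · have hloc : ∀ p : ↥R, ∃ U : Set ↥R, IsOpen U ∧ p ∈ U ∧
        Set.InjOn (fun p : ↥R => (p : X × X).1) U := by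
      intro p
      obtain ⟨e, hpe, hfe⟩ := hr p
      refine ⟨e.source, e.open_source, hpe, ?_⟩
      rw [hfe]
      exact e.injOn
    choose U hUo hUm hUi using hloc
    obtain ⟨t, ht⟩ := isCompact_univ.elim_finite_subcover U hUo
      (fun p _ => Set.mem_iUnion.2 ⟨p, hUm p⟩)
    have hmem : ∀ p : ↥R, ∃ i ∈ t, p ∈ U i := by
      intro p
      simpa using ht (Set.mem_univ p)
    choose g hgt hgU using hmem
    refine ⟨t.card, fun x => ?_⟩
    let f : {y | (x, y) ∈ R} → t := fun y => ⟨g ⟨(x, y.1), y.2⟩, hgt _⟩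
    have hf : Function.Injective f := by
      rintro ⟨y, hy⟩ ⟨z, hz⟩ hyz
      have h1 : g ⟨(x, y), hy⟩ = g ⟨(x, z), hz⟩ := congrArg Subtype.val hyz
      have h2 := hgU ⟨(x, y), hy⟩
      rw [h1] at h2
      have h3 := hUi _ h2 (hgU ⟨(x, z), hz⟩) rfl
      have h4 : y = z := congrArg (fun p : ↥R => (p : X × X).2) h3
      exact Subtype.ext h4
    have hfin : Finite {y | (x, y) ∈ R} := Finite.of_injective f hf
    refine ⟨Set.toFinite _, ?_⟩
    have := Nat.card_le_card_of_injective f hf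
    simpa [Set.ncard] using this
end

section
/- Let (R,T) be a CEER on a compact, metrizable, zero-dimensional space X, and let V' and V be finite clopen partitions of R and of X, respectively. Then there exists a groupoid partition O' of R which is finer than V', and such that O = O' ∩ Δ_X is a finite clopen partition of X that is finer than V. -/
open Set Topology MeasureTheory

universe u v

/-- Membership patterns in a finite clopen family are locally constant. -/
lemma isClopen_pattern {Z : Type*} [TopologicalSpace Z] {ι : Type*} [Finite ι]
    (S : ι → Set Z) (hS : ∀ i, IsClopen (S i)) (a : Set ι) :
    IsClopen {x | {i | x ∈ S i} = a} := by
  have : {x | {i | x ∈ S i} = a} = ⋂ i, {x | x ∈ S i ↔ i ∈ a} := by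
    ext x
    simp [Set.ext_iff]
  rw [this]
  refine isClopen_iInter_of_finite fun i => ?_
  by_cases hi : i ∈ a
  · simpa [hi] using hS i
  · simp only [hi, iff_false]
    exact (hS i).compl

lemma relSubTop_eq {X : Type u} [TopologicalSpace X] {R : Set (X × X)} {U : Set (X × X)}
    (hU : U ⊆ R) :
    relSubTop (instTopologicalSpaceSubtype : TopologicalSpace ↥R) U
      = instTopologicalSpaceSubtype := by
  apply le_antisymm
  · exact induced_mono (coinduced_le_iff_le_induced.2 le_rfl)
  · intro W hW
    obtain ⟨W1, hW1, rfl⟩ := hW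
    obtain ⟨W0, hW0, h0⟩ := hW1
    refine ⟨W0, hW0, ?_⟩
    ext p
    have := Set.ext_iff.1 h0 ⟨p.1, hU p.2⟩
    exact this

/-- For a CEER `(R, T)` on a compact, metrizable, zero-dimensional space
`X`, and finite clopen partitions `V'` of `R` and `V` of `X`, there is a groupoid
partition `O'` of `R` finer than `V'` whose trace `O = O' ∩ Δ_X` on the diagonal is a
finite clopen partition of `X` finer than `V`. -/
theorem exists_groupoid_partition {X : Type} [TopologicalSpace X] [CompactSpace X]
    [TopologicalSpace.MetrizableSpace X] [TotallyDisconnectedSpace X]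
    (R : Set (X × X)) (T : TopologicalSpace ↥R) (h : IsCEER R T)
    (V' : Set (Set (X × X))) (hV' : IsClopenPartitionRel R T V')
    (V : Set (Set X)) (hV : IsClopenPartitionSpace X V) :
    ∃ O' : Set (Set (X × X)), IsGroupoidPartition R T O' ∧ FinerThan O' V' ∧
      IsClopenPartitionSpace X (diagTrace O') ∧ FinerThan (diagTrace O') V := by
  classical
  obtain ⟨hE, hcomp⟩ := h
  obtain rfl : T = instTopologicalSpaceSubtype := by
    letI := T
    have h1 : Continuous fun p : ↥R => (p : X × X).1 := hE.localHomeo_range.continuous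
    have h2 : Continuous fun p : ↥R => (p : X × X).2 := h1.comp hE.homeo_inv.continuous
    have h3 : Continuous fun p : ↥R => (p : X × X) := h1.prodMk h2
    exact (h3.isClosedEmbedding Subtype.val_injective).isEmbedding.eq_induced
  have hRefl := hE.refl
  have hSymm := hE.symm
  have hTrans := hE.trans
  have hloc := hE.localHomeo_range
  have hr : Continuous fun p : ↥R => (p : X × X).1 := hloc.continuous
  have hs : Continuous fun p : ↥R => (p : X × X).2 := continuous_snd.comp continuous_subtype_val
  have hrClopen : ∀ S : Set ↥R, IsClopen S → IsClopen ((fun p : ↥R => (p : X × X).1) '' S) :=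
    fun S hS => ⟨hr.isClosedMap _ hS.1, hloc.isOpenMap _ hS.2⟩
  -- the diagonal is open in `R`
  have hDiag : IsOpen {p : ↥R | (p : X × X).1 = (p : X × X).2} := by
    rw [isOpen_iff_mem_nhds]
    rintro ⟨⟨x, x'⟩, hx⟩ hxx
    obtain rfl : x = x' := hxx
    obtain ⟨e, he, hee⟩ := hloc ⟨(x, x), hx⟩
    have hN : e.source ∈ 𝓝 (⟨(x, x), hx⟩ : ↥R) := e.open_source.mem_nhds he
    have hd : Continuous fun p : ↥R => (⟨(p.1.1, p.1.1), hRefl _⟩ : ↥R) :=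
      (hr.prodMk hr).subtype_mk _
    have hN' := hd.continuousAt.preimage_mem_nhds
      (x := (⟨(x, x), hx⟩ : ↥R)) (t := e.source) hN
    filter_upwards [hN, hN'] with p hp hp'
    have := e.injOn hp hp' (by rw [← hee])
    have h2 := congrArg (fun q : ↥R => (q : X × X).2) this
    exact h2.symm
  -- finite clopen family separating distinct equivalent points
  obtain ⟨𝒜, h𝒜fin, h𝒜clopen, h𝒜sep⟩ : ∃ 𝒜 : Set (Set X), 𝒜.Finite ∧
      (∀ A ∈ 𝒜, IsClopen A) ∧
      ∀ p ∈ R, p.1 ≠ p.2 → ∃ A ∈ 𝒜, p.1 ∈ A ∧ p.2 ∉ A := by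
    have hK : IsCompact {p : ↥R | (p : X × X).1 = (p : X × X).2}ᶜ :=
      hDiag.isClosed_compl.isCompact
    obtain ⟨t, ht⟩ := hK.elim_finite_subcover
      (fun A : {A : Set X // IsClopen A} => {p : ↥R | p.1.1 ∈ A.1 ∧ p.1.2 ∈ A.1ᶜ})
      (fun A => (A.2.isOpen.preimage hr).inter (A.2.compl.isOpen.preimage hs))
      (by
        intro p hp
        obtain ⟨A, hA, h1, h2⟩ := exists_isClopen_of_totally_separated (show p.1.1 ≠ p.1.2 from hp)
        exact Set.mem_iUnion.2 ⟨⟨A, hA⟩, h1, h2⟩)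
    refine ⟨Subtype.val '' (t : Set {A : Set X // IsClopen A}), t.finite_toSet.image _, ?_, ?_⟩
    · rintro _ ⟨A, -, rfl⟩
      exact A.2
    · intro p hp hne
      have := ht (show (⟨p, hp⟩ : ↥R) ∈ _ from hne)
      simp only [Set.mem_iUnion] at this
      obtain ⟨A, hA, h1, h2⟩ := this
      exact ⟨A.1, ⟨A, hA, rfl⟩, h1, h2⟩
  obtain ⟨hVfin, hVcl, hVdisj, hVcov⟩ := hV
  obtain ⟨hV'fin, hV'cl, hV'disj, hV'cov⟩ := hV'
  -- colouring
  obtain ⟨C, hCfin, c, hc, hcinj, hcV⟩ : ∃ (C : Type) (_ : Finite C) (c : X → C),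
      (∀ a, IsClopen {x | c x = a}) ∧ (∀ x y, (x, y) ∈ R → c x = c y → x = y) ∧
      (∀ x y, c x = c y → ∀ v ∈ V, x ∈ v → y ∈ v) := by
    haveI : Finite ↥(𝒜 ∪ V) := (h𝒜fin.union hVfin).to_subtype
    refine ⟨Set ↥(𝒜 ∪ V), inferInstance, fun x => {i | x ∈ i.1}, ?_, ?_, ?_⟩
    · refine isClopen_pattern (fun i : ↥(𝒜 ∪ V) => i.1) ?_
      rintro ⟨A, hA | hA⟩
      · exact h𝒜clopen A hA
      · exact (hVcl A hA).2
    · intro x y hxy hcxy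
      by_contra hne
      obtain ⟨A, hA, h1, h2⟩ := h𝒜sep (x, y) hxy hne
      exact h2 ((Set.ext_iff.1 hcxy ⟨A, Or.inl hA⟩).1 h1)
    · intro x y hcxy v hv hx
      exact (Set.ext_iff.1 hcxy ⟨v, Or.inr hv⟩).1 hx
  haveI : Finite ↥V' := hV'fin.to_subtype
  -- saturated sets
  let Sat : C × C × ↥V' → Set X := fun t =>
    {x | ∃ y z, (x, y) ∈ R ∧ (y, z) ∈ R ∧ c y = t.1 ∧ c z = t.2.1 ∧ (y, z) ∈ t.2.2.1}
  have hSat : ∀ t, IsClopen (Sat t) := by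
    intro t
    have h1 : IsClopen {p : ↥R | c p.1.1 = t.1 ∧ c p.1.2 = t.2.1 ∧ p.1 ∈ t.2.2.1} :=
      ((hc t.1).preimage hr).inter (((hc t.2.1).preimage hs).inter (hV'cl _ t.2.2.2).2.2)
    have h2 := hrClopen _ ((hrClopen _ h1).preimage hs)
    convert h2 using 1
    ext x
    constructor
    · rintro ⟨y, z, hxy, hyz, h⟩
      exact ⟨⟨(x, y), hxy⟩, ⟨⟨(y, z), hyz⟩, h, rfl⟩, rfl⟩
    · rintro ⟨⟨⟨x', y⟩, hxy⟩, ⟨⟨⟨y', z⟩, hyz⟩, h, hy⟩, hx⟩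
      obtain rfl : y' = y := hy
      obtain rfl : x' = x := hx
      exact ⟨y', z, hxy, hyz, h⟩
  let D : X → Set (C × C × ↥V') := fun x => {t | x ∈ Sat t}
  have hD : ∀ a, IsClopen {x | D x = a} := isClopen_pattern Sat hSat
  have hDle : ∀ x y, (x, y) ∈ R → D x ⊆ D y := by
    rintro x y hxy t ⟨u, w, h1, h2⟩
    exact ⟨u, w, hTrans (hSymm hxy) h1, h2⟩
  have hDinv : ∀ x y, (x, y) ∈ R → D x = D y := fun x y hxy =>
    (hDle x y hxy).antisymm (hDle y x (hSymm hxy))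
  have hDmem : ∀ x y, (x, y) ∈ R → ∀ v (hv : v ∈ V'), (x, y) ∈ v →
      (c x, c y, (⟨v, hv⟩ : ↥V')) ∈ D x := fun x y hxy v hv hm =>
    ⟨x, y, hRefl x, hxy, rfl, rfl, hm⟩
  have hV'ex : ∀ p ∈ R, ∃ v ∈ V', p ∈ v := fun p hp => by
    rw [← hV'cov] at hp
    exact hp
  have hEx : ∀ x y z, (x, y) ∈ R → D z = D x → ∃ w, (z, w) ∈ R ∧ c w = c y := by
    intro x y z hxy hz
    obtain ⟨v, hv, hm⟩ := hV'ex _ hxy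
    have := hDmem x y hxy v hv hm
    rw [← hz] at this
    obtain ⟨u, w, h1, h2, -, h4, -⟩ := this
    exact ⟨w, hTrans h1 h2, h4⟩
  let κ : X × X → C × C × Set (C × C × ↥V') := fun q => (c q.1, c q.2, D q.1)
  have hκ : ∀ p q, κ p = κ q ↔ c p.1 = c q.1 ∧ c p.2 = c q.2 ∧ D p.1 = D q.1 := by
    intro p q
    simp [κ, Prod.ext_iff]
  let F : C × C × Set (C × C × ↥V') → Set (X × X) := fun k => {q | q ∈ R ∧ κ q = k}
  have hFcl : ∀ k, IsClopen ((Subtype.val : ↥R → X × X) ⁻¹' (F k)) := by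
    rintro ⟨a, b, d⟩
    have h1 : IsClopen {p : ↥R | c p.1.1 = a ∧ c p.1.2 = b ∧ D p.1.1 = d} :=
      ((hc a).preimage hr).inter (((hc b).preimage hs).inter ((hD d).preimage hr))
    convert h1 using 1
    ext p
    simp [F, κ, Prod.ext_iff]
  let O : Set (Set (X × X)) := {U | ∃ p ∈ R, U = F (κ p)}
  have hOfin : O.Finite := by
    refine (Set.finite_range F).subset ?_
    rintro _ ⟨p, -, rfl⟩
    exact ⟨_, rfl⟩
  have hOeq : ∀ U ∈ O, ∀ q ∈ U, U = F (κ q) := by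
    rintro _ ⟨p, hp, rfl⟩ q hq
    rw [hq.2]
  have hOdisj : ∀ U ∈ O, ∀ U' ∈ O, ∀ q, q ∈ U → q ∈ U' → U = U' := by
    intro U hU U' hU' q h1 h2
    rw [hOeq U hU q h1, hOeq U' hU' q h2]
  have hOR : ∀ U ∈ O, U ⊆ R := by
    rintro _ ⟨p, hp, rfl⟩ q hq
    exact hq.1
  have hOne : ∀ U ∈ O, U.Nonempty := by
    rintro _ ⟨p, hp, rfl⟩
    exact ⟨p, hp, rfl⟩
  have hOcl : ∀ U ∈ O, IsClopen ((Subtype.val : ↥R → X × X) ⁻¹' U) := by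
    rintro _ ⟨p, hp, rfl⟩
    exact hFcl _
  have hOdiag : ∀ x, F (κ (x, x)) ⊆ Set.diagonal X := by
    rintro x ⟨y, z⟩ ⟨hR, hk⟩
    rw [hκ] at hk
    exact hcinj y z hR (hk.1.trans hk.2.1.symm)
  have hFV' : FinerThan O V' := by
    rintro _ ⟨⟨x, y⟩, hp, rfl⟩
    obtain ⟨v, hv, hm⟩ := hV'ex _ hp
    refine ⟨v, hv, ?_⟩
    rintro ⟨x', y'⟩ ⟨hq, hk⟩
    rw [hκ] at hk
    obtain ⟨h1, h2, h3⟩ := hk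
    have := hDmem x y hp v hv hm
    change D x' = D x at h3
    rw [← h3] at this
    obtain ⟨u, w, g1, g2, g3, g4, g5⟩ := this
    obtain rfl : x' = u := hcinj _ _ g1 (h1.trans g3.symm)
    obtain rfl : y' = w := hcinj _ _ (hTrans (hSymm hq) g2) (h2.trans g4.symm)
    exact g5
  have hemb1 : ∀ U ∈ O, ∀ p ∈ U, ∀ q ∈ U, p.1 = q.1 → p = q := by
    rintro _ ⟨p0, hp0, rfl⟩ ⟨x, y⟩ ⟨hp, hk⟩ ⟨x', y'⟩ ⟨hq, hk'⟩ hxx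
    obtain rfl : x = x' := hxx
    have := (hκ _ _).1 (hk.trans hk'.symm)
    obtain rfl : y = y' := hcinj _ _ (hTrans (hSymm hp) hq) this.2.1
    rfl
  have hemb2 : ∀ U ∈ O, ∀ p ∈ U, ∀ q ∈ U, p.2 = q.2 → p = q := by
    rintro _ ⟨p0, hp0, rfl⟩ ⟨x, y⟩ ⟨hp, hk⟩ ⟨x', y'⟩ ⟨hq, hk'⟩ hyy
    obtain rfl : y = y' := hyy
    have := (hκ _ _).1 (hk.trans hk'.symm)
    obtain rfl : x = x' := hcinj _ _ (hTrans hp (hSymm hq)) this.1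
    rfl
  have hOcompact : ∀ U ∈ O, CompactSpace ↥U := by
    intro U hU
    have h1 := ((hOcl U hU).isClosed.isCompact).image continuous_subtype_val
    rw [Subtype.image_preimage_coe, Set.inter_eq_right.2 (hOR U hU)] at h1
    exact isCompact_iff_compactSpace.1 h1
  refine ⟨O, ⟨⟨hOfin, fun U hU => ⟨hOR U hU, hOne U hU, hOcl U hU⟩, ?_, ?_⟩,
    ?_, ?_, ?_, ?_, ?_⟩, hFV', ⟨?_, ?_, ?_, ?_⟩, ?_⟩
  · intro U hU U' hU' hne
    refine Set.disjoint_left.2 fun q h1 h2 => hne (hOdisj U hU U' hU' q h1 h2)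
  · ext p
    constructor
    · rintro ⟨U, hU, hp⟩
      exact hOR U hU hp
    · intro hp
      exact ⟨F (κ p), ⟨p, hp, rfl⟩, hp, rfl⟩
  · rintro _ ⟨⟨x, y⟩, hp, rfl⟩
    by_cases hxy : x = y
    · subst hxy
      exact Or.inl (hOdiag x)
    · right
      rintro ⟨x', y'⟩ ⟨hq, hk⟩
      refine ⟨hq, fun hd => hxy ?_⟩
      obtain rfl : x' = y' := hd
      rw [hκ] at hk
      exact hcinj x y hp (hk.1.symm.trans hk.2.1)
  · intro U hU
    haveI := hOcompact U hU
    rw [relSubTop_eq (hOR U hU)]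
    refine ⟨((continuous_fst.comp continuous_subtype_val).isClosedEmbedding ?_).isEmbedding,
      ((continuous_snd.comp continuous_subtype_val).isClosedEmbedding ?_).isEmbedding⟩
    · intro p q hpq
      exact Subtype.ext (hemb1 U hU p.1 p.2 q.1 q.2 hpq)
    · intro p q hpq
      exact Subtype.ext (hemb2 U hU p.1 p.2 q.1 q.2 hpq)
  · rintro _ ⟨⟨x, y⟩, hp, rfl⟩ hsub
    ext z
    simp only [Set.mem_inter_iff, Set.mem_empty_iff_false, iff_false]
    rintro ⟨⟨⟨z1, w1⟩, ⟨h1, k1⟩, e1⟩, ⟨⟨w2, z2⟩, ⟨h2, k2⟩, e2⟩⟩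
    obtain rfl : z1 = z := e1
    obtain rfl : z2 = z1 := e2
    rw [hκ] at k1 k2
    have hxy : x = y := hcinj x y hp (k1.1.symm.trans k2.2.1)
    exact (hsub (show (x, y) ∈ F (κ (x, y)) from ⟨hp, rfl⟩)).2 hxy
  · intro U hU W hW
    rcases Set.eq_empty_or_nonempty (SetComp U W) with h0 | ⟨⟨x, z⟩, y, h1, h2⟩
    · exact Or.inl h0
    · right
      have hxy : (x, y) ∈ R := hOR U hU h1
      have hyz : (y, z) ∈ R := hOR W hW h2
      have hxz : (x, z) ∈ R := hTrans hxy hyz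
      refine ⟨(x, z), hxz, ?_⟩
      rw [hOeq U hU _ h1, hOeq W hW _ h2]
      ext ⟨x', z'⟩
      constructor
      · rintro ⟨y', ⟨g1, k1⟩, ⟨g2, k2⟩⟩
        rw [hκ] at k1 k2
        exact ⟨hTrans g1 g2, (hκ _ _).2 ⟨k1.1, k2.2.1, k1.2.2⟩⟩
      · rintro ⟨g, k⟩
        rw [hκ] at k
        obtain ⟨y', g1, g2⟩ := hEx x y x' hxy k.2.2
        refine ⟨y', ⟨g1, (hκ _ _).2 ⟨k.1, g2, k.2.2⟩⟩,
          ⟨hTrans (hSymm g1) g, (hκ _ _).2 ⟨g2, k.2.1, ?_⟩⟩⟩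
        exact (hDinv _ _ g1).symm.trans (k.2.2.trans (hDinv _ _ hxy))
  · rintro _ ⟨⟨x, y⟩, hp, rfl⟩
    refine ⟨(y, x), hSymm hp, ?_⟩
    ext ⟨a, b⟩
    constructor
    · rintro ⟨g, k⟩
      rw [hκ] at k
      exact ⟨hSymm g, (hκ _ _).2 ⟨k.2.1, k.1,
        (hDinv _ _ g).symm.trans (k.2.2.trans (hDinv _ _ hp))⟩⟩
    · rintro ⟨g, k⟩
      rw [hκ] at k
      exact ⟨hSymm g, (hκ _ _).2 ⟨k.2.1, k.1,
        (hDinv _ _ g).symm.trans (k.2.2.trans (hDinv _ _ (hSymm hp)))⟩⟩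
  · refine (hOfin.image (fun U => Prod.fst '' U)).subset ?_
    rintro _ ⟨U, hU, -, rfl⟩
    exact ⟨U, hU, rfl⟩
  · rintro _ ⟨U, hU, -, rfl⟩
    refine ⟨(hOne U hU).image _, ?_⟩
    have h1 := hrClopen _ (hOcl U hU)
    convert h1 using 1
    ext x
    constructor
    · rintro ⟨p, hp, rfl⟩
      exact ⟨⟨p, hOR U hU hp⟩, hp, rfl⟩
    · rintro ⟨p, hp, rfl⟩
      exact ⟨p.1, hp, rfl⟩
  · rintro _ ⟨U, hU, hUd, rfl⟩ _ ⟨U', hU', hUd', rfl⟩ hne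
    refine Set.disjoint_left.2 ?_
    rintro x ⟨⟨x1, y1⟩, h1, e1⟩ ⟨⟨x2, y2⟩, h2, e2⟩
    obtain rfl : x1 = x := e1
    obtain rfl : x2 = x1 := e2
    obtain rfl : x2 = y1 := hUd h1
    obtain rfl : x2 = y2 := hUd' h2
    exact hne (by rw [hOdisj U hU U' hU' _ h1 h2])
  · refine Set.eq_univ_of_forall fun x => ?_
    exact ⟨Prod.fst '' F (κ (x, x)), ⟨_, ⟨(x, x), hRefl x, rfl⟩, hOdiag x, rfl⟩,
      ⟨(x, x), ⟨hRefl x, rfl⟩, rfl⟩⟩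
  · rintro _ ⟨_, ⟨⟨x, y⟩, hp, rfl⟩, -, rfl⟩
    obtain ⟨v, hv, hxv⟩ : x ∈ ⋃₀ V := by rw [hVcov]; trivial
    refine ⟨v, hv, ?_⟩
    rintro _ ⟨q, ⟨hq, hk⟩, rfl⟩
    exact hcV x q.1 ((hκ _ _).1 hk).1.symm v hv hxv
end

section
/- Let R and S be equivalence relations on a compact, metrizable, zero-dimensional space X with R ∩ S = Δ_X, and suppose there exists a bijection h : R×_X S → S×_X R satisfying r∘h = r and s∘h = s. Then the equivalence relation R ∨ S generated by R and S equals r×s(R×_X S), and also equals r×s(S×_X R); furthermore the map r×s : R×_X S → R ∨ S is a bijection (and likewise r×s : S×_X R → R ∨ S is a bijection). In particular this holds when R and S are transverse étale equivalence relations on X. -/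
open Set Topology MeasureTheory

universe u v

/-- `r × s` is injective on a fibred product of equivalence relations meeting in the diagonal. -/
theorem rs_injective_aux {X : Type} (R S : Set (X × X)) (hR : IsEquivRel R) (hS : IsEquivRel S)
    (hmeet : R ∩ S ⊆ Set.diagonal X) :
    Function.Injective (fun q : Fib R S => (fibR q, fibS q)) := by
  rintro ⟨⟨⟨⟨x, y⟩, h1⟩, ⟨⟨y1, z⟩, h2⟩⟩, e⟩ ⟨⟨⟨⟨x', y'⟩, h1'⟩, ⟨⟨y1', z'⟩, h2'⟩⟩, e'⟩ heq
  simp only [fibR, fibS, Prod.mk.injEq] at heq e e'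
  obtain ⟨rfl, rfl⟩ := heq
  subst e e'
  have hy : (y, y') ∈ Set.diagonal X :=
    hmeet ⟨hR.2.2 (hR.2.1 h1) h1', hS.2.2 h2 (hS.2.1 h2')⟩
  have hy' : y = y' := hy
  subst hy'
  rfl

/-- Membership in the image of `r × s`. -/
theorem rs_mem_aux {X : Type} (R S : Set (X × X)) (x z : X) :
    (x, z) ∈ Set.range (fun q : Fib R S => (fibR q, fibS q)) ↔
      ∃ y, (x, y) ∈ R ∧ (y, z) ∈ S := by
  constructor
  · rintro ⟨⟨⟨⟨⟨x, y⟩, h1⟩, ⟨⟨y1, z⟩, h2⟩⟩, e⟩, heq⟩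
    simp only [fibR, fibS, Prod.mk.injEq] at heq e
    obtain ⟨rfl, rfl⟩ := heq
    subst e
    exact ⟨y, h1, h2⟩
  · rintro ⟨y, h1, h2⟩
    exact ⟨⟨⟨⟨(x, y), h1⟩, ⟨(y, z), h2⟩⟩, rfl⟩, rfl⟩

/-- Let `R`, `S` be equivalence relations on `X` with `R ∩ S = Δ_X`,
admitting a bijection `h : R ×_X S → S ×_X R` with `r ∘ h = r`, `s ∘ h = s`. Then
`R ∨ S = (r × s)(R ×_X S) = (r × s)(S ×_X R)`, and `r × s` is a bijection from
`R ×_X S` (and from `S ×_X R`) onto `R ∨ S`. -/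
theorem join_eq_rs_image {X : Type} [TopologicalSpace X] [CompactSpace X]
    [TopologicalSpace.MetrizableSpace X] [TotallyDisconnectedSpace X]
    (R S : Set (X × X)) (hR : IsEquivRel R) (hS : IsEquivRel S)
    (hmeet : R ∩ S = Set.diagonal X)
    (h : Fib R S → Fib S R) (hbij : Function.Bijective h)
    (hr : ∀ q, fibR (h q) = fibR q) (hs : ∀ q, fibS (h q) = fibS q) :
    Set.range (fun q : Fib R S => (fibR q, fibS q)) = joinRel R S ∧
    Set.range (fun q : Fib S R => (fibR q, fibS q)) = joinRel R S ∧
    Function.Injective (fun q : Fib R S => (fibR q, fibS q)) ∧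
    Function.Injective (fun q : Fib S R => (fibR q, fibS q)) := by
  have hrange : Set.range (fun q : Fib R S => (fibR q, fibS q)) =
      Set.range (fun q : Fib S R => (fibR q, fibS q)) := by
    ext p
    constructor
    · rintro ⟨q, rfl⟩
      exact ⟨h q, by simp only [hr, hs]⟩
    · rintro ⟨q, rfl⟩
      obtain ⟨q, rfl⟩ := hbij.2 q
      exact ⟨q, by simp only [hr, hs]⟩
  have hswap : ∀ x z, (∃ y, (x, y) ∈ R ∧ (y, z) ∈ S) ↔ ∃ y, (x, y) ∈ S ∧ (y, z) ∈ R := by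
    intro x z
    rw [← rs_mem_aux, ← rs_mem_aux, hrange]
  have hjoin : Set.range (fun q : Fib R S => (fibR q, fibS q)) = joinRel R S := by
    apply Set.Subset.antisymm
    · rintro _ ⟨q, rfl⟩
      exact (rsFun R S q).2
    · rintro ⟨x, z⟩ hxz
      rw [rs_mem_aux]
      change Relation.EqvGen _ x z at hxz
      induction hxz with
      | rel a b hab =>
        rcases hab with hab | hab
        · exact ⟨b, hab, hS.1 b⟩
        · exact ⟨a, hR.1 a, hab⟩
      | refl a => exact ⟨a, hR.1 a, hS.1 a⟩
      | symm a b _ ih =>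
        obtain ⟨y, h1, h2⟩ := ih
        exact (hswap b a).2 ⟨y, hS.2.1 h2, hR.2.1 h1⟩
      | trans a b c _ _ ih1 ih2 =>
        obtain ⟨y, h1, h2⟩ := ih1
        obtain ⟨w, h3, h4⟩ := ih2
        obtain ⟨v, h5, h6⟩ := (hswap y w).2 ⟨b, h2, h3⟩
        exact ⟨v, hR.2.2 h1 h5, hS.2.2 h6 h4⟩
  exact ⟨hjoin, hrange ▸ hjoin, rs_injective_aux R S hR hS hmeet.subset,
    rs_injective_aux S R hS hR (by rw [Set.inter_comm]; exact hmeet.subset)⟩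
end

section
/- Let (R,T) and (S,T̃) be two étale equivalence relations on a compact, metrizable, zero-dimensional space X which are transverse to each other. Transfer the topology on R×_X S (relative topology from R × S) to R ∨ S via the bijection r×s : R×_X S → R ∨ S, and call the resulting topology W. Then: (R ∨ S, W) is an étale equivalence relation on X; if R and S are CEERs then (R ∨ S, W) is a CEER; W is the unique étale topology on R ∨ S whose relative topologies on R and on S are T and T̃, respectively; and both R and S are open subsets of (R ∨ S, W). -/
open Set Topology MeasureTheory

universe u v

section Helpers

variable {X : Type} [TopologicalSpace X]

theorem aux_cont_inv {R : Set (X × X)} {T : TopologicalSpace ↥R} (hR : IsEtaleEquivRel R T)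
    {Z : Type} [TopologicalSpace Z] {f k : Z → ↥R} (hf : Continuous f)
    (hk : ∀ z, (k z).1 = ((f z).1.2, (f z).1.1)) : Continuous k := by
  have h : k = invMap R hR.symm ∘ f := by
    funext z; exact Subtype.ext (hk z)
  rw [h]
  exact hR.homeo_inv.continuous.comp hf

theorem aux_cont_r {R : Set (X × X)} {T : TopologicalSpace ↥R} (hR : IsEtaleEquivRel R T) :
    Continuous (fun p : ↥R => p.1.1) := hR.localHomeo_range.continuous

theorem aux_cont_s {R : Set (X × X)} {T : TopologicalSpace ↥R} (hR : IsEtaleEquivRel R T) :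
    Continuous (fun p : ↥R => p.1.2) :=
  (aux_cont_r hR).comp (hR.homeo_inv.continuous)

theorem aux_cont_mul {R : Set (X × X)} {T : TopologicalSpace ↥R} (hR : IsEtaleEquivRel R T)
    {Z : Type} [TopologicalSpace Z] {f g k : Z → ↥R} (hf : Continuous f) (hg : Continuous g)
    (hfg : ∀ z, (f z).1.2 = (g z).1.1)
    (hk : ∀ z, (k z).1 = ((f z).1.1, (g z).1.2)) : Continuous k := by
  have h : k = compMap R hR.trans ∘ (fun z => ⟨(f z, g z), hfg z⟩) := by
    funext z; exact Subtype.ext (hk z)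
  rw [h]
  refine Continuous.comp (hR.continuous_comp) ?_
  exact Continuous.subtype_mk (hf.prodMk hg) _

theorem aux_cont_unit {R : Set (X × X)} {T : TopologicalSpace ↥R} (hR : IsEtaleEquivRel R T)
    {Z : Type} [TopologicalSpace Z] {f : Z → X} {k : Z → ↥R} (hf : Continuous f)
    (hk : ∀ z, (k z).1 = (f z, f z)) : Continuous k := by
  let u : X → ↥R := fun x => ⟨(x, x), hR.refl x⟩
  have hu : Continuous u := by
    have hq : IsQuotientMap (fun p : ↥R => p.1.1) :=
      hR.localHomeo_range.isOpenMap.isQuotientMap hR.localHomeo_range.continuous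
        (fun x => ⟨u x, rfl⟩)
    rw [hq.continuous_iff]
    exact aux_cont_mul hR continuous_id
      (aux_cont_inv hR (k := invMap R hR.symm) continuous_id (fun _ => rfl))
      (fun _ => rfl) (fun _ => rfl)
  have h : k = u ∘ f := by funext z; exact Subtype.ext (hk z)
  rw [h]; exact hu.comp hf

theorem aux_diag_open {R : Set (X × X)} {T : TopologicalSpace ↥R} (hR : IsEtaleEquivRel R T) :
    IsOpen {p : ↥R | p.1.1 = p.1.2} := by
  rw [isOpen_iff_mem_nhds]
  intro p hp
  let d : ↥R → ↥R := fun p => ⟨(p.1.1, p.1.1), hR.refl _⟩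
  have hd : Continuous d := aux_cont_unit hR (aux_cont_r hR) (fun _ => rfl)
  obtain ⟨e, hpe, he⟩ := hR.localHomeo_range p
  have hdp : d p = p := Subtype.ext (Prod.ext rfl hp)
  have h1 : e.source ∈ nhds p := e.open_source.mem_nhds hpe
  have h2 : d ⁻¹' e.source ∈ nhds p := hd.continuousAt.preimage_mem_nhds (by rw [hdp]; exact h1)
  filter_upwards [h1, h2] with q hq1 hq2
  have : d q = q := e.injOn hq2 hq1 (by rw [← he])
  have h3 := congrArg (fun t : ↥R => t.1.2) this
  exact h3

theorem aux_relSub {J : Set (X × X)} (W : TopologicalSpace ↥J) (U : Set (X × X)) (hU : U ⊆ J) :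
    relSubTop W U = TopologicalSpace.induced (Set.inclusion hU) W := by
  ext s
  constructor
  · rintro ⟨V, hV, rfl⟩
    exact ⟨_, hV, rfl⟩
  · rintro ⟨V, hV, rfl⟩
    refine ⟨Subtype.val '' V, ?_, ?_⟩
    · change IsOpen[W] _
      rwa [Set.preimage_image_eq _ Subtype.val_injective]
    · ext p
      constructor
      · rintro ⟨q, hq, hqp⟩
        have : q = Set.inclusion hU p := Subtype.ext hqp
        rw [this] at hq; exact hq
      · intro h
        exact ⟨_, h, rfl⟩

end Helpers

section Join

variable {X : Type} [TopologicalSpace X] {R S : Set (X × X)}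

theorem aux_rs_inj (hR : IsEquivRel R) (hS : IsEquivRel S)
    (h : R ∩ S = Set.diagonal X) : Function.Injective (rsFun R S) := by
  rintro ⟨⟨⟨⟨x, y⟩, hxy⟩, ⟨⟨y1, z⟩, hyz⟩⟩, h1⟩ ⟨⟨⟨⟨x', y'⟩, hxy'⟩, ⟨⟨y1', z'⟩, hyz'⟩⟩, h1'⟩ heq
  have h2 := congrArg Subtype.val heq
  simp only [rsFun, fibR, fibS, Prod.mk.injEq] at h2 h1 h1'
  obtain ⟨rfl, rfl⟩ := h2
  subst h1 h1'
  have : (y, y') ∈ R ∩ S := ⟨hR.2.2 (hR.2.1 hxy) hxy', hS.2.2 hyz (hS.2.1 hyz')⟩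
  rw [h] at this
  have h3 : y = y' := this
  subst h3
  rfl

theorem aux_rs_surj (hR : IsEquivRel R) (hS : IsEquivRel S)
    (h : ∀ x y z, (x, y) ∈ S → (y, z) ∈ R → ∃ u, (x, u) ∈ R ∧ (u, z) ∈ S)
    {x z : X} (hxz : (x, z) ∈ joinRel R S) : ∃ y, (x, y) ∈ R ∧ (y, z) ∈ S := by
  have hxz' : Relation.EqvGen (fun a b => (a, b) ∈ R ∨ (a, b) ∈ S) x z := hxz
  clear hxz
  induction hxz' with
  | rel a b hab =>
    rcases hab with hab | hab
    · exact ⟨b, hab, hS.1 b⟩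
    · exact ⟨a, hR.1 a, hab⟩
  | refl a => exact ⟨a, hR.1 a, hS.1 a⟩
  | symm a b _ ih =>
    obtain ⟨y, h1, h2⟩ := ih
    exact h _ _ _ (hS.2.1 h2) (hR.2.1 h1)
  | trans a b c _ _ ih1 ih2 =>
    obtain ⟨y, h1, h2⟩ := ih1
    obtain ⟨y', h1', h2'⟩ := ih2
    obtain ⟨u, h3, h4⟩ := h _ _ _ h2 h1'
    exact ⟨u, hR.2.2 h1 h3, hS.2.2 h4 h2'⟩

/-- The range map on the fibred product is a local homeomorphism. -/
theorem aux_fibR_local {T : TopologicalSpace ↥R} {T' : TopologicalSpace ↥S}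
    (hR : IsEtaleEquivRel R T) (hS : IsEtaleEquivRel S T') :
    IsLocalHomeomorph (fun q : Fib R S => q.1.1.1.1) := by
  have hp : IsLocalHomeomorph (fun q : Fib R S => q.1.1) := by
    have hc : Continuous (fun q : Fib R S => q.1.1) := continuous_fst.comp continuous_subtype_val
    have ho : IsOpenMap (fun q : Fib R S => q.1.1) := by
      intro O hO
      rw [isOpen_iff_mem_nhds]
      rintro _ ⟨q, hq, rfl⟩
      obtain ⟨O', hO', rfl⟩ := hO
      obtain ⟨U, V, hU, hV, hqU, hqV, hUV⟩ := isOpen_prod_iff.1 hO' q.1.1 q.1.2 hq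
      have hrV : IsOpen ((fun p : ↥S => p.1.1) '' V) := hS.localHomeo_range.isOpenMap V hV
      have h2 : IsOpen ((fun p : ↥R => p.1.2) ⁻¹' ((fun p : ↥S => p.1.1) '' V)) :=
        hrV.preimage (aux_cont_s hR)
      filter_upwards [hU.mem_nhds hqU, h2.mem_nhds ⟨q.1.2, hqV, q.2.symm⟩] with p hp1 hp2
      obtain ⟨t, ht, htp⟩ := hp2
      exact ⟨⟨(p, t), htp.symm⟩, hUV ⟨hp1, ht⟩, rfl⟩
    rw [isLocalHomeomorph_iff_isOpenEmbedding_restrict]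
    intro q
    obtain ⟨e, hqe, he⟩ := hS.localHomeo_range q.1.2
    have hOp : IsOpen {a : Fib R S | a.1.2 ∈ e.source} :=
      e.open_source.preimage (continuous_snd.comp continuous_subtype_val)
    refine ⟨{a : Fib R S | a.1.2 ∈ e.source}, hOp.mem_nhds hqe, ?_⟩
    refine IsOpenEmbedding.of_continuous_injective_isOpenMap
      (hc.comp continuous_subtype_val) ?_ (ho.domRestrict hOp)
    rintro ⟨a, ha⟩ ⟨b, hb⟩ hab
    have hab1 : a.1.1 = b.1.1 := hab
    have hab2 : a.1.2 = b.1.2 := by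
      refine e.injOn ha hb ?_
      rw [← he]
      change a.1.2.1.1 = b.1.2.1.1
      rw [← a.2, ← b.2, hab1]
    exact Subtype.ext (Subtype.ext (Prod.ext hab1 hab2))
  exact hR.localHomeo_range.comp hp

end Join

theorem join_transverse_etale {X : Type} [TopologicalSpace X] [CompactSpace X]
    [TopologicalSpace.MetrizableSpace X] [TotallyDisconnectedSpace X]
    (R S : Set (X × X)) (T : TopologicalSpace ↥R) (T' : TopologicalSpace ↥S)
    (hR : IsEtaleEquivRel R T) (hS : IsEtaleEquivRel S T')
    (htr : AreTransverse R T S T') :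
    IsEtaleEquivRel (joinRel R S) (joinTop R S T T') ∧
    (@CompactSpace ↥R T → @CompactSpace ↥S T' →
      @CompactSpace ↥(joinRel R S) (joinTop R S T T')) ∧
    relSubTop (joinTop R S T T') R = T ∧
    relSubTop (joinTop R S T T') S = T' ∧
    IsOpen[joinTop R S T T'] ((Subtype.val : ↥(joinRel R S) → X × X) ⁻¹' R) ∧
    IsOpen[joinTop R S T T'] ((Subtype.val : ↥(joinRel R S) → X × X) ⁻¹' S) ∧
    ∀ W' : TopologicalSpace ↥(joinRel R S), IsEtaleEquivRel (joinRel R S) W' →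
      relSubTop W' R = T → relSubTop W' S = T' → W' = joinTop R S T T' := by
  obtain ⟨hdiag, h, hh, hhr, hhs⟩ := htr
  have eR : IsEquivRel R := ⟨hR.refl, hR.symm, hR.trans⟩
  have eS : IsEquivRel S := ⟨hS.refl, hS.symm, hS.trans⟩
  -- inverse of the transversality homeomorphism
  have hh' : IsHomeomorph h := hh
  obtain ⟨g, hg, hhg⟩ : ∃ g : Fib S R → Fib R S, Continuous g ∧ ∀ q, h (g q) = q :=
    ⟨(hh'.homeomorph h).symm, (hh'.homeomorph h).symm.continuous,
      fun q => (hh'.homeomorph h).apply_symm_apply q⟩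
  have hgr : ∀ q, (g q).1.1.1.1 = q.1.1.1.1 := fun q => by
    have := hhr (g q); rw [hhg] at this; exact this.symm
  have hgs : ∀ q, (g q).1.2.1.2 = q.1.2.1.2 := fun q => by
    have := hhs (g q); rw [hhg] at this; exact this.symm
  have hcomm : ∀ x y z, (x, y) ∈ S → (y, z) ∈ R → ∃ u, (x, u) ∈ R ∧ (u, z) ∈ S := by
    intro x y z hxy hyz
    let q : Fib S R := ⟨(⟨(x, y), hxy⟩, ⟨(y, z), hyz⟩), rfl⟩
    refine ⟨(g q).1.1.1.2, ?_, ?_⟩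
    · have h1 := (g q).1.1.2
      have h2 : (g q).1.1.1 = (x, (g q).1.1.1.2) := Prod.ext (hgr q) rfl
      rwa [h2] at h1
    · have h1 := (g q).1.2.2
      have h2 : (g q).1.2.1 = ((g q).1.1.1.2, z) := Prod.ext (g q).2.symm (hgs q)
      rwa [h2] at h1
  have hsub_R : R ⊆ joinRel R S := fun p hp => Relation.EqvGen.rel _ _ (Or.inl hp)
  have hsub_S : S ⊆ joinRel R S := fun p hp => Relation.EqvGen.rel _ _ (Or.inr hp)
  have hbij : Function.Bijective (rsFun R S) := by
    refine ⟨aux_rs_inj eR eS hdiag, ?_⟩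
    rintro ⟨⟨x, z⟩, hxz⟩
    obtain ⟨y, h1, h2⟩ := aux_rs_surj eR eS hcomm hxz
    exact ⟨⟨(⟨(x, y), h1⟩, ⟨(y, z), h2⟩), rfl⟩, rfl⟩
  -- abbreviations for continuity of coordinates
  have c1 : Continuous (fun q : Fib R S => q.1.1) := continuous_fst.comp continuous_subtype_val
  have c2 : Continuous (fun q : Fib R S => q.1.2) := continuous_snd.comp continuous_subtype_val
  let W : TopologicalSpace ↥(joinRel R S) := joinTop R S T T'
  have hcont : Continuous (rsFun R S) := continuous_coinduced_rng
  have hiff : ∀ s : Set ↥(joinRel R S), IsOpen s ↔ IsOpen (rsFun R S ⁻¹' s) := fun s => Iff.rfl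
  have hrs : IsHomeomorph (rsFun R S) := by
    refine ⟨hcont, ?_, hbij⟩
    intro O hO
    rw [hiff, Set.preimage_image_eq _ hbij.1]
    exact hO
  let e : Fib R S ≃ₜ ↥(joinRel R S) := hrs.homeomorph _
  have he1 : ∀ p, (e.symm p).1.1.1.1 = p.1.1 := fun p =>
    congrArg (fun t : ↥(joinRel R S) => t.1.1) (e.apply_symm_apply p)
  have he2 : ∀ p, (e.symm p).1.2.1.2 = p.1.2 := fun p =>
    congrArg (fun t : ↥(joinRel R S) => t.1.2) (e.apply_symm_apply p)
  have hclosed : IsClosed {q : ↥R × ↥S | q.1.1.2 = q.2.1.1} :=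
    isClosed_eq ((aux_cont_s hR).comp continuous_fst) ((aux_cont_r hS).comp continuous_snd)
  have hce : IsClosedEmbedding (Subtype.val : Fib R S → ↥R × ↥S) := hclosed.isClosedEmbedding_subtypeVal
  have := hR.t2
  have := hS.t2
  have := hR.locallyCompact
  have := hS.locallyCompact
  have := hR.secondCountable
  have := hS.secondCountable
  have jsymm : ∀ ⦃x y : X⦄, (x, y) ∈ joinRel R S → (y, x) ∈ joinRel R S :=
    fun x y hxy => Relation.EqvGen.symm _ _ hxy
  have jtrans : ∀ ⦃x y z : X⦄, (x, y) ∈ joinRel R S → (y, z) ∈ joinRel R S →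
      (x, z) ∈ joinRel R S := fun x y z h1 h2 => Relation.EqvGen.trans _ _ _ h1 h2
  have hrloc : IsLocalHomeomorph (fun p : ↥(joinRel R S) => p.1.1) := by
    have h1 := (aux_fibR_local hR hS).comp e.symm.isLocalHomeomorph
    have h2 : (fun p : ↥(joinRel R S) => p.1.1) = (fun q : Fib R S => q.1.1.1.1) ∘ e.symm := by
      funext p; exact (he1 p).symm
    rw [h2]; exact h1
  -- a criterion for continuity into the join
  have hcrit : ∀ {Z : Type} [TopologicalSpace Z] (k : Z → ↥(joinRel R S)) (F : Z → Fib R S),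
      Continuous F → (∀ z, (k z).1 = ((F z).1.1.1.1, (F z).1.2.1.2)) → Continuous k := by
    intro Z _ k F hF hk
    have : k = rsFun R S ∘ F := by funext z; exact Subtype.ext (hk z)
    rw [this]; exact hcont.comp hF
  have hinv : Continuous (invMap (joinRel R S) jsymm) := by
    let a : ↥(joinRel R S) → Fib S R := fun p =>
      ⟨(invMap S hS.symm (e.symm p).1.2, invMap R hR.symm (e.symm p).1.1), (e.symm p).2.symm⟩
    have ha : Continuous a := by
      refine Continuous.subtype_mk (Continuous.prodMk ?_ ?_) _
      · exact hS.homeo_inv.continuous.comp (c2.comp e.symm.continuous)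
      · exact hR.homeo_inv.continuous.comp (c1.comp e.symm.continuous)
    refine hcrit _ (g ∘ a) (hg.comp ha) (fun p => ?_)
    refine Prod.ext ?_ ?_
    · exact ((hgr (a p)).trans (he2 p)).symm
    · exact ((hgs (a p)).trans (he1 p)).symm
  have hcomp : Continuous (compMap (joinRel R S) jtrans) := by
    let p1 : ↥(CompPairs (joinRel R S)) → Fib R S := fun q => e.symm q.1.1
    let p2 : ↥(CompPairs (joinRel R S)) → Fib R S := fun q => e.symm q.1.2
    have hp1 : Continuous p1 := e.symm.continuous.comp (continuous_fst.comp continuous_subtype_val)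
    have hp2 : Continuous p2 := e.symm.continuous.comp (continuous_snd.comp continuous_subtype_val)
    let m : ↥(CompPairs (joinRel R S)) → Fib S R := fun q =>
      ⟨((p1 q).1.2, (p2 q).1.1), ((he2 q.1.1).trans q.2).trans (he1 q.1.2).symm⟩
    have hm : Continuous m := Continuous.subtype_mk ((c2.comp hp1).prodMk (c1.comp hp2)) _
    have hgm : Continuous (g ∘ m) := hg.comp hm
    have k1 : ∀ q, (p1 q).1.1.1.2 = (g (m q)).1.1.1.1 := fun q =>
      ((p1 q).2).trans (hgr (m q)).symm
    have k2 : ∀ q, (g (m q)).1.2.1.2 = (p2 q).1.2.1.1 := fun q =>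
      (hgs (m q)).trans (p2 q).2
    let a : ↥(CompPairs (joinRel R S)) → ↥R := fun q =>
      compMap R hR.trans ⟨((p1 q).1.1, (g (m q)).1.1), k1 q⟩
    let b : ↥(CompPairs (joinRel R S)) → ↥S := fun q =>
      compMap S hS.trans ⟨((g (m q)).1.2, (p2 q).1.2), k2 q⟩
    have ha : Continuous a :=
      aux_cont_mul hR (c1.comp hp1) (c1.comp hgm) k1 (fun _ => rfl)
    have hb : Continuous b :=
      aux_cont_mul hS (c2.comp hgm) (c2.comp hp2) k2 (fun _ => rfl)
    refine hcrit _ (fun q => ⟨(a q, b q), (g (m q)).2⟩) (Continuous.subtype_mk (ha.prodMk hb) _) ?_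
    intro q
    exact Prod.ext (he1 q.1.1).symm (he2 q.1.2).symm
  have hetale : IsEtaleEquivRel (joinRel R S) W :=
    { refl := fun x => Relation.EqvGen.refl x
      symm := jsymm
      trans := jtrans
      countable := by
        intro x
        refine ((hR.countable x).biUnion (fun y _ => hS.countable y)).mono ?_
        intro z hz
        obtain ⟨y, h1, h2⟩ := aux_rs_surj eR eS hcomm hz
        exact Set.mem_biUnion h1 h2
      t2 := e.t2Space
      locallyCompact := by
        have : LocallyCompactSpace (Fib R S) := hce.locallyCompactSpace
        exact e.symm.isClosedEmbedding.locallyCompactSpace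
      secondCountable := by
        have : SecondCountableTopology (Fib R S) :=
          hce.isEmbedding.secondCountableTopology
        exact e.symm.secondCountableTopology
      continuous_comp := hcomp
      homeo_inv := by
        have hinvol : ∀ p, invMap (joinRel R S) jsymm (invMap (joinRel R S) jsymm p) = p :=
          fun _ => rfl
        exact isHomeomorph_iff_exists_inverse.2 ⟨hinv, _, hinvol, hinvol, hinv⟩
      localHomeo_range := hrloc }
  refine ⟨hetale, ?_, ?_, ?_, ?_, ?_, ?_⟩
  · intro hcR hcS
    have : CompactSpace (Fib R S) := hce.compactSpace
    exact e.compactSpace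
  · change relSubTop W R = T
    rw [aux_relSub W R hsub_R]
    have hu : Continuous (fun p : ↥R => (⟨(p.1.2, p.1.2), hS.refl _⟩ : ↥S)) :=
      aux_cont_unit hS (aux_cont_s hR) (fun _ => rfl)
    have hi : Continuous (Set.inclusion hsub_R) :=
      hcrit _ (fun p : ↥R => ⟨(p, ⟨(p.1.2, p.1.2), hS.refl _⟩), rfl⟩)
        (Continuous.subtype_mk (continuous_id.prodMk hu) _) (fun _ => rfl)
    have hleft : ∀ p : ↥R, (e.symm (Set.inclusion hsub_R p)).1.1 = p := by
      intro p
      have : e.symm (Set.inclusion hsub_R p) = ⟨(p, ⟨(p.1.2, p.1.2), hS.refl _⟩), rfl⟩ := by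
        rw [e.symm_apply_eq]; rfl
      rw [this]
    have hind : IsInducing (Set.inclusion hsub_R) := by
      refine IsInducing.of_comp hi (c1.comp e.symm.continuous) ?_
      have : ((fun q : Fib R S => q.1.1) ∘ e.symm) ∘ Set.inclusion hsub_R = id := by
        funext p; exact hleft p
      rw [this]; exact IsInducing.id
    exact hind.eq_induced.symm
  · change relSubTop W S = T'
    rw [aux_relSub W S hsub_S]
    have hu : Continuous (fun p : ↥S => (⟨(p.1.1, p.1.1), hR.refl _⟩ : ↥R)) :=
      aux_cont_unit hR (aux_cont_r hS) (fun _ => rfl)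
    have hi : Continuous (Set.inclusion hsub_S) :=
      hcrit _ (fun p : ↥S => ⟨(⟨(p.1.1, p.1.1), hR.refl _⟩, p), rfl⟩)
        (Continuous.subtype_mk (hu.prodMk continuous_id) _) (fun _ => rfl)
    have hleft : ∀ p : ↥S, (e.symm (Set.inclusion hsub_S p)).1.2 = p := by
      intro p
      have : e.symm (Set.inclusion hsub_S p) = ⟨(⟨(p.1.1, p.1.1), hR.refl _⟩, p), rfl⟩ := by
        rw [e.symm_apply_eq]; rfl
      rw [this]
    have hind : IsInducing (Set.inclusion hsub_S) := by
      refine IsInducing.of_comp hi (c2.comp e.symm.continuous) ?_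
      have : ((fun q : Fib R S => q.1.2) ∘ e.symm) ∘ Set.inclusion hsub_S = id := by
        funext p; exact hleft p
      rw [this]; exact IsInducing.id
    exact hind.eq_induced.symm
  · change IsOpen (rsFun R S ⁻¹' (Subtype.val ⁻¹' R))
    have h1 : IsOpen ((fun q : Fib R S => q.1.2) ⁻¹' {p : ↥S | p.1.1 = p.1.2}) :=
      (aux_diag_open hS).preimage c2
    convert h1 using 1
    ext ⟨⟨⟨⟨x, y⟩, hxy⟩, ⟨⟨y', z⟩, hyz⟩⟩, hy⟩
    change y = y' at hy
    subst hy
    change (x, z) ∈ R ↔ y = z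
    constructor
    · intro hxz
      have : (y, z) ∈ R ∩ S := ⟨hR.trans (hR.symm hxy) hxz, hyz⟩
      rw [hdiag] at this
      exact this
    · rintro rfl
      exact hxy
  · change IsOpen (rsFun R S ⁻¹' (Subtype.val ⁻¹' S))
    have h1 : IsOpen ((fun q : Fib R S => q.1.1) ⁻¹' {p : ↥R | p.1.1 = p.1.2}) :=
      (aux_diag_open hR).preimage c1
    convert h1 using 1
    ext ⟨⟨⟨⟨x, y⟩, hxy⟩, ⟨⟨y', z⟩, hyz⟩⟩, hy⟩
    change y = y' at hy
    subst hy
    change (x, z) ∈ S ↔ x = y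
    constructor
    · intro hxz
      have : (x, y) ∈ R ∩ S := ⟨hxy, hS.trans hxz (hS.symm hyz)⟩
      rw [hdiag] at this
      exact this
    · rintro rfl
      exact hyz
  · intro W' hW' hWR hWS
    rw [aux_relSub W' R hsub_R] at hWR
    rw [aux_relSub W' S hsub_S] at hWS
    have iR : @Continuous _ _ T W' (Set.inclusion hsub_R) := by
      rw [← hWR]; exact continuous_induced_dom
    have iS : @Continuous _ _ T' W' (Set.inclusion hsub_S) := by
      rw [← hWS]; exact continuous_induced_dom
    have hk : @Continuous _ _ (fibTop T T') W' (rsFun R S) :=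
      aux_cont_mul hW' (@Continuous.comp _ _ _ _ _ W' _ _ iR c1)
        (@Continuous.comp _ _ _ _ _ W' _ _ iS c2) (fun q => q.2) (fun _ => rfl)
    have hloc : @IsLocalHomeomorph _ _ (fibTop T T') W' (rsFun R S) :=
      @IsLocalHomeomorph.of_comp _ _ _ (fibTop T T') W' _ (fun p => p.1.1) _ (aux_fibR_local hR hS)
        hW'.localHomeo_range hk
    have hopen := @IsLocalHomeomorph.isOpenMap _ _ (fibTop T T') W' _ hloc
    apply le_antisymm
    · intro O hO
      have h1 : IsOpen[fibTop T T'] (rsFun R S ⁻¹' O) := hO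
      have h2 := hopen _ h1
      rwa [Set.image_preimage_eq _ hbij.2] at h2
    · exact continuous_iff_coinduced_le.1 hk
end

section
/- Let (R,T) be an étale equivalence relation and (S,T̃) a CEER on a compact, metrizable, zero-dimensional space X, and suppose R and S are transverse to each other. Then for every (x,y) ∈ R, the S-equivalence classes of x and of y have the same (finite) number of elements: #([x]_S) = #([y]_S). -/
open Set Topology MeasureTheory

universe u v

/-- The classes of a CEER are finite. -/
theorem ceer_class_finite {X : Type} [TopologicalSpace X] [T1Space X]
    (S : Set (X × X)) (T' : TopologicalSpace ↥S) (hS : IsCEER S T') (x : X) :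
    {z | (x, z) ∈ S}.Finite := by
  obtain ⟨hE, hC⟩ := hS
  have hloc := hE.localHomeo_range
  letI := T'
  have hclosed : IsClosed ((fun p : ↥S => (p : X × X).1) ⁻¹' {x}) :=
    isClosed_singleton.preimage hloc.continuous
  have hfin : ((fun p : ↥S => (p : X × X).1) ⁻¹' {x}).Finite := by
    refine hclosed.isCompact.finite ?_
    rw [isDiscrete_iff_forall_exists_isOpen]
    intro p hp
    obtain ⟨e, hpe, he⟩ := hloc p
    refine ⟨e.source, e.open_source, ?_⟩
    ext q
    constructor
    · rintro ⟨hq, hqx⟩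
      refine e.injOn hq hpe ?_
      rw [← he]
      exact Eq.trans hqx (Eq.symm hp)
    · rintro rfl
      exact ⟨hpe, hp⟩
  refine (hfin.image (fun p : ↥S => (p : X × X).2)).subset ?_
  intro z hz
  exact ⟨⟨(x, z), hz⟩, rfl, rfl⟩

/-- One inequality between the cardinalities of the classes. -/
theorem transverse_class_le {X : Type} [TopologicalSpace X] [T1Space X]
    (R S : Set (X × X)) (T : TopologicalSpace ↥R) (T' : TopologicalSpace ↥S)
    (hR : IsEtaleEquivRel R T) (hS : IsCEER S T')
    (htr : AreTransverse R T S T') (x y : X) (hxy : (x, y) ∈ R) :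
    {z | (y, z) ∈ S}.ncard ≤ {z | (x, z) ∈ S}.ncard := by
  obtain ⟨hint, h, -, hr, hs⟩ := htr
  have key : ∀ z, ∃ w, (y, z) ∈ S → (x, w) ∈ S ∧ (w, z) ∈ R := by
    intro z
    by_cases hz : (y, z) ∈ S
    · let q : Fib R S := ⟨(⟨(x, y), hxy⟩, ⟨(y, z), hz⟩), rfl⟩
      have h1 : ((h q).1.1 : X × X).1 = x := hr q
      have h2 : ((h q).1.2 : X × X).2 = z := hs q
      have h3 := (h q).2
      refine ⟨((h q).1.1 : X × X).2, fun _ => ⟨?_, ?_⟩⟩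
      · rw [← h1]
        exact (h q).1.1.2
      · rw [h3, ← h2]
        exact (h q).1.2.2
    · exact ⟨x, fun h => absurd h hz⟩
  choose f hf using key
  refine Set.ncard_le_ncard_of_injOn f (fun z hz => (hf z hz).1) ?_ (ceer_class_finite S T' hS x)
  intro z hz z' hz' hzz
  have hRz : (z, z') ∈ R := by
    refine hR.trans (hR.symm (hf z hz).2) ?_
    rw [hzz]
    exact (hf z' hz').2
  have hSz : (z, z') ∈ S := hS.1.trans (hS.1.symm hz) hz'
  have : (z, z') ∈ Set.diagonal X := hint ▸ (⟨hRz, hSz⟩ : (z, z') ∈ R ∩ S)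
  exact this

/-- If `(R, T)` is étale, `(S, T̃)` is a CEER, and `R ⊥ S`, then for
every `(x, y) ∈ R` the `S`-classes of `x` and `y` are finite with the same number of
elements. -/
theorem transverse_class_card {X : Type} [TopologicalSpace X] [CompactSpace X]
    [TopologicalSpace.MetrizableSpace X] [TotallyDisconnectedSpace X]
    (R S : Set (X × X)) (T : TopologicalSpace ↥R) (T' : TopologicalSpace ↥S)
    (hR : IsEtaleEquivRel R T) (hS : IsCEER S T')
    (htr : AreTransverse R T S T') :
    ∀ x y : X, (x, y) ∈ R →
      {z | (x, z) ∈ S}.Finite ∧ {z | (y, z) ∈ S}.Finite ∧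
        {z | (x, z) ∈ S}.ncard = {z | (y, z) ∈ S}.ncard := by
  intro x y hxy
  exact ⟨ceer_class_finite S T' hS x, ceer_class_finite S T' hS y,
    le_antisymm (transverse_class_le R S T T' hR hS htr y x (hR.symm hxy))
      (transverse_class_le R S T T' hR hS htr x y hxy)⟩
end

section
/- Let (R,T) and (S,T̃) be two transverse CEERs on a compact, metrizable, zero-dimensional space X, and give R ∨ S the CEER structure obtained by transferring the topology of R×_X S via r×s. Let O' be a groupoid partition of R ∨ S that is finer than the clopen partition {Δ_X, R∖Δ_X, S∖Δ_X, (R∨S)∖(R∪S)}. Then for every U ∈ O' there are unique elements U_R, U_S, V_R, V_S ∈ O' with U_R, V_R ⊆ R, U_S, V_S ⊆ S and U = U_R·U_S = V_S·V_R. Moreover O'|_R = O' ∩ R and O'|_S = O' ∩ S are groupoid partitions of R and of S, respectively. -/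
open Set Topology MeasureTheory

universe u v

theorem aux_cont_fst {X : Type u} [TopologicalSpace X] {R : Set (X × X)}
    {T : TopologicalSpace ↥R} (h : IsEtaleEquivRel R T) :
    @Continuous _ _ T _ (fun p : ↥R => (p : X × X).1) :=
  letI := T
  h.localHomeo_range.continuous

theorem aux_cont_snd {X : Type u} [TopologicalSpace X] {R : Set (X × X)}
    {T : TopologicalSpace ↥R} (h : IsEtaleEquivRel R T) :
    @Continuous _ _ T _ (fun p : ↥R => (p : X × X).2) :=
  letI := T
  (aux_cont_fst h).comp h.homeo_inv.continuous

/-- The unit map is continuous. -/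
theorem aux_cont_unit_s10 {X : Type u} [TopologicalSpace X] {R : Set (X × X)}
    {T : TopologicalSpace ↥R} (h : IsEtaleEquivRel R T) :
    @Continuous _ _ _ T (fun x : X => (⟨(x, x), h.refl x⟩ : ↥R)) := by
  letI := T
  have hq : IsQuotientMap (fun p : ↥R => (p : X × X).1) :=
    h.localHomeo_range.isOpenMap.isQuotientMap h.localHomeo_range.continuous
      (fun x => ⟨⟨(x, x), h.refl x⟩, rfl⟩)
  rw [hq.continuous_iff]
  have hc : Continuous (compMap R h.trans) := h.continuous_comp
  have hp : Continuous (fun p : ↥R => (⟨(p, invMap R h.symm p), rfl⟩ : ↥(CompPairs R))) :=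
    Continuous.subtype_mk (continuous_id.prodMk h.homeo_inv.continuous) _
  exact hc.comp hp

theorem aux_embedding {X : Type u} [TopologicalSpace X] [T2Space X] {R : Set (X × X)}
    {T : TopologicalSpace ↥R} (hc : @CompactSpace ↥R T) {U : Set (X × X)} (hU : U ⊆ R)
    (hcl : @IsClosed _ T ((Subtype.val : ↥R → X × X) ⁻¹' U)) (f : X × X → X)
    (hf : @Continuous _ _ T _ (fun p : ↥R => f p))
    (hinj : Function.Injective (fun p : ↥U => f p)) :
    @Topology.IsEmbedding ↥U X (relSubTop T U) _ (fun p => f p) := by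
  letI := T
  letI TU : TopologicalSpace ↥U := relSubTop T U
  have hcont : Continuous (fun p : ↥U => f p) := by
    letI TX : TopologicalSpace (X × X) :=
      TopologicalSpace.coinduced (Subtype.val : ↥R → X × X) T
    have h1 : Continuous f := continuous_coinduced_dom.2 hf
    exact h1.comp continuous_induced_dom
  have hcomp : CompactSpace ↥U := by
    have : CompactSpace ↥((Subtype.val : ↥R → X × X) ⁻¹' U) :=
      isCompact_iff_compactSpace.1 hcl.isCompact
    let g : ↥((Subtype.val : ↥R → X × X) ⁻¹' U) → ↥U := fun p => ⟨p.1.1, p.2⟩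
    have hg : Continuous g := by
      refine continuous_induced_rng.2 ?_
      letI TX : TopologicalSpace (X × X) :=
        TopologicalSpace.coinduced (Subtype.val : ↥R → X × X) T
      have h1 : Continuous (Subtype.val : ↥R → X × X) := continuous_coinduced_rng
      exact h1.comp continuous_subtype_val
    have hs : Function.Surjective g := fun p => ⟨⟨⟨p.1, hU p.2⟩, p.2⟩, rfl⟩
    exact hs.compactSpace hg
  exact (hcont.isClosedEmbedding hinj).isEmbedding

theorem aux_restrict {X : Type u} [TopologicalSpace X] [T2Space X] {Q K : Set (X × X)}
    {TQ : TopologicalSpace ↥Q} {TK : TopologicalSpace ↥K} (hQ : IsCEER Q TQ)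
    (hQK : Q ⊆ K) (hincl : @Continuous _ _ TQ TK (Set.inclusion hQK))
    {P : Set (Set (X × X))} (hP : IsGroupoidPartition K TK P)
    (hsub : ∀ U ∈ P, ∀ p ∈ U, p ∈ Q → U ⊆ Q) :
    IsGroupoidPartition Q TQ {U ∈ P | U ⊆ Q} := by
  obtain ⟨⟨hfin, hcl, hdisj, hun⟩, hdiag, hemb, hrs, hcomp, hinv⟩ := hP
  obtain ⟨hE, hc⟩ := hQ
  have hclop : ∀ U ∈ P, @IsClopen _ TQ ((Subtype.val : ↥Q → X × X) ⁻¹' U) := by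
    intro U hU
    letI := TQ
    letI := TK
    exact (hcl U hU).2.2.preimage hincl
  refine ⟨⟨hfin.subset (fun U h => h.1), fun U hU => ⟨hU.2, (hcl U hU.1).2.1, hclop U hU.1⟩,
    hdisj.subset (fun U h => h.1), ?_⟩, ?_, ?_, ?_, ?_, ?_⟩
  · ext p
    constructor
    · rintro ⟨U, hU, hp⟩
      exact hU.2 hp
    · intro hp
      have hpK : p ∈ ⋃₀ P := hun.symm ▸ hQK hp
      obtain ⟨U, hU, hpU⟩ := hpK
      exact ⟨U, ⟨hU, hsub U hU p hpU hp⟩, hpU⟩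
  · intro U hU
    rcases hdiag U hU.1 with h | h
    · exact Or.inl h
    · exact Or.inr fun p hp => ⟨hU.2 hp, (h hp).2⟩
  · intro U hU
    have hclosed : @IsClosed _ TQ ((Subtype.val : ↥Q → X × X) ⁻¹' U) := by
      letI := TQ
      exact (hclop U hU.1).isClosed
    obtain ⟨h1, h2⟩ := hemb U hU.1
    letI TU : TopologicalSpace ↥U := relSubTop TK U
    exact ⟨aux_embedding hc hU.2 hclosed Prod.fst (aux_cont_fst hE) h1.injective,
      aux_embedding hc hU.2 hclosed Prod.snd (aux_cont_snd hE) h2.injective⟩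
  · intro U hU h
    exact hrs U hU.1 fun p hp => ⟨hQK (hU.2 hp), (h hp).2⟩
  · intro U hU V hV
    rcases hcomp U hU.1 V hV.1 with h | h
    · exact Or.inl h
    · refine Or.inr ⟨h, ?_⟩
      rintro ⟨x, z⟩ ⟨y, hy1, hy2⟩
      exact hE.trans (hU.2 hy1) (hV.2 hy2)
  · intro U hU
    refine ⟨hinv U hU.1, ?_⟩
    rintro ⟨x, y⟩ h
    exact hE.symm (hU.2 h)

theorem aux_decomp {X : Type u} {A B K : Set (X × X)} {P : Set (Set (X × X))}
    (hne : ∀ U ∈ P, U.Nonempty) (hK : ∀ U ∈ P, U ⊆ K)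
    (hdisj : P.PairwiseDisjoint id) (hun : ⋃₀ P = K)
    (hcomp : ∀ U ∈ P, ∀ V ∈ P, SetComp U V = ∅ ∨ SetComp U V ∈ P)
    (hAK : A ⊆ K) (hBK : B ⊆ K)
    (hKAB : K ⊆ SetComp A B)
    (hu : ∀ x z y y', (x, y) ∈ A → (y, z) ∈ B → (x, y') ∈ A → (y', z) ∈ B → y = y')
    (hA : ∀ U ∈ P, ∀ p ∈ U, p ∈ A → U ⊆ A) (hB : ∀ U ∈ P, ∀ p ∈ U, p ∈ B → U ⊆ B)
    (U : Set (X × X)) (hU : U ∈ P) :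
    ∃! pr : Set (X × X) × Set (X × X),
        pr.1 ∈ P ∧ pr.1 ⊆ A ∧ pr.2 ∈ P ∧ pr.2 ⊆ B ∧ U = SetComp pr.1 pr.2 := by
  have heq : ∀ V ∈ P, ∀ W ∈ P, ∀ p, p ∈ V → p ∈ W → V = W := by
    intro V hV W hW p h1 h2
    by_contra hne'
    exact Set.disjoint_left.1 (hdisj hV hW hne') h1 h2
  obtain ⟨⟨x, z⟩, hxz⟩ := hne U hU
  obtain ⟨y, hy1, hy2⟩ := hKAB (hK U hU hxz)
  simp only at hy1 hy2
  have h1 : (x, y) ∈ ⋃₀ P := hun.symm ▸ hAK hy1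
  have h2 : (y, z) ∈ ⋃₀ P := hun.symm ▸ hBK hy2
  obtain ⟨V, hV, hyV⟩ := h1
  obtain ⟨W, hW, hyW⟩ := h2
  refine ⟨(V, W), ⟨hV, hA V hV _ hyV hy1, hW, hB W hW _ hyW hy2, ?_⟩, ?_⟩
  · have hmem : (x, z) ∈ SetComp V W := ⟨y, hyV, hyW⟩
    rcases hcomp V hV W hW with h | h
    · rw [h] at hmem
      exact hmem.elim
    · exact heq U hU _ h _ hxz hmem
  · rintro ⟨V', W'⟩ ⟨hV', hVA, hW', hWB, rfl⟩
    obtain ⟨y', hyone, hytwo⟩ := hxz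
    simp only at hyone hytwo hV' hW' hVA hWB
    obtain rfl := hu x z y y' hy1 hy2 (hVA hyone) (hWB hytwo)
    exact Prod.ext (heq _ hV' _ hV _ hyone hyV) (heq _ hW' _ hW _ hytwo hyW)

/-- Let `(R, T)` and `(S, T̃)` be transverse CEERs and `O'` a groupoid
partition of `R ∨ S` finer than `{Δ_X, R∖Δ_X, S∖Δ_X, (R∨S)∖(R∪S)}`. Then every
`U ∈ O'` has unique decompositions `U = U_R · U_S = V_S · V_R` with
`U_R, V_R ∈ O'` contained in `R` and `U_S, V_S ∈ O'` contained in `S`; moreover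
`O'|_R` and `O'|_S` are groupoid partitions of `R` and `S`. -/
theorem groupoid_partition_decomposition {X : Type} [TopologicalSpace X] [CompactSpace X]
    [TopologicalSpace.MetrizableSpace X] [TotallyDisconnectedSpace X]
    (R S : Set (X × X)) (T : TopologicalSpace ↥R) (T' : TopologicalSpace ↥S)
    (hR : IsCEER R T) (hS : IsCEER S T') (htr : AreTransverse R T S T')
    (P : Set (Set (X × X)))
    (hP : IsGroupoidPartition (joinRel R S) (joinTop R S T T') P)
    (hfiner : ∀ U ∈ P, U ⊆ Set.diagonal X ∨ U ⊆ R \ Set.diagonal X ∨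
      U ⊆ S \ Set.diagonal X ∨ U ⊆ joinRel R S \ (R ∪ S)) :
    (∀ U ∈ P,
      (∃! pr : Set (X × X) × Set (X × X),
        pr.1 ∈ P ∧ pr.1 ⊆ R ∧ pr.2 ∈ P ∧ pr.2 ⊆ S ∧ U = SetComp pr.1 pr.2) ∧
      (∃! pr : Set (X × X) × Set (X × X),
        pr.1 ∈ P ∧ pr.1 ⊆ S ∧ pr.2 ∈ P ∧ pr.2 ⊆ R ∧ U = SetComp pr.1 pr.2)) ∧
    IsGroupoidPartition R T {U ∈ P | U ⊆ R} ∧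
    IsGroupoidPartition S T' {U ∈ P | U ⊆ S} := by
  obtain ⟨hinter, h, hh, hhR, hhS⟩ := htr
  have hER := hR.1
  have hES := hS.1
  have hRS : ∀ x, (x ∈ R ∧ x ∈ S) → x.1 = x.2 := fun p hp => by
    have : p ∈ Set.diagonal X := hinter ▸ hp
    exact this
  -- commutation of the two relations
  have hc1 : SetComp R S ⊆ SetComp S R := by
    rintro ⟨x, z⟩ ⟨y, h1, h2⟩
    have e1 := hhR ⟨(⟨(x, y), h1⟩, ⟨(y, z), h2⟩), rfl⟩
    have e2 := hhS ⟨(⟨(x, y), h1⟩, ⟨(y, z), h2⟩), rfl⟩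
    generalize h ⟨(⟨(x, y), h1⟩, ⟨(y, z), h2⟩), rfl⟩ = q at e1 e2
    obtain ⟨⟨⟨⟨a, b⟩, hab⟩, ⟨⟨c, d⟩, hcd⟩⟩, e⟩ := q
    simp only [fibR, fibS] at e e1 e2
    subst e e1 e2
    exact ⟨_, hab, hcd⟩
  have hc2 : SetComp S R ⊆ SetComp R S := by
    rintro ⟨x, z⟩ ⟨y, h1, h2⟩
    obtain ⟨w, hw1, hw2⟩ := @hc1 (z, x) ⟨y, hER.symm h2, hES.symm h1⟩
    exact ⟨w, hER.symm hw2, hES.symm hw1⟩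
  have hKRS : joinRel R S ⊆ SetComp R S := by
    rintro ⟨x, z⟩ hxz
    change Relation.EqvGen _ x z at hxz
    induction hxz with
    | rel x y h =>
      rcases h with h | h
      · exact ⟨y, h, hES.refl _⟩
      · exact ⟨x, hER.refl _, h⟩
    | refl x => exact ⟨x, hER.refl _, hES.refl _⟩
    | symm x y _ ih =>
      obtain ⟨w, h1, h2⟩ := ih
      exact hc2 ⟨w, hES.symm h2, hER.symm h1⟩
    | trans x y z _ _ ih1 ih2 =>
      obtain ⟨v, h1, h2⟩ := ih1
      obtain ⟨w, h3, h4⟩ := ih2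
      obtain ⟨t, h5, h6⟩ := @hc2 (v, w) ⟨y, h2, h3⟩
      exact ⟨t, hER.trans h1 h5, hES.trans h6 h4⟩
  have hRK : R ⊆ joinRel R S := fun p hp => Relation.EqvGen.rel _ _ (Or.inl hp)
  have hSK : S ⊆ joinRel R S := fun p hp => Relation.EqvGen.rel _ _ (Or.inr hp)
  have hsubR : ∀ U ∈ P, ∀ p ∈ U, p ∈ R → U ⊆ R := by
    intro U hU p hp hpR
    rcases hfiner U hU with h | h | h | h
    · rintro ⟨a, b⟩ hab
      obtain rfl : a = b := h hab
      exact hER.refl _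
    · exact fun q hq => (h hq).1
    · exact ((h hp).2 (hRS p ⟨hpR, (h hp).1⟩)).elim
    · exact ((h hp).2 (Or.inl hpR)).elim
  have hsubS : ∀ U ∈ P, ∀ p ∈ U, p ∈ S → U ⊆ S := by
    intro U hU p hp hpS
    rcases hfiner U hU with h | h | h | h
    · rintro ⟨a, b⟩ hab
      obtain rfl : a = b := h hab
      exact hES.refl _
    · exact ((h hp).2 (hRS p ⟨(h hp).1, hpS⟩)).elim
    · exact fun q hq => (h hq).1
    · exact ((h hp).2 (Or.inr hpS)).elim
  have hcR : @Continuous _ _ T (joinTop R S T T') (Set.inclusion hRK) := by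
    letI := T
    letI := T'
    letI := joinTop R S T T'
    have h1 : Continuous (rsFun R S) := continuous_coinduced_rng
    have h2 : Continuous (fun p : ↥R =>
        (⟨(p, ⟨(p.1.2, p.1.2), hES.refl _⟩), rfl⟩ : Fib R S)) :=
      Continuous.subtype_mk
        (continuous_id.prodMk ((aux_cont_unit_s10 hES).comp (aux_cont_snd hER))) _
    exact h1.comp h2
  have hcS : @Continuous _ _ T' (joinTop R S T T') (Set.inclusion hSK) := by
    letI := T
    letI := T'
    letI := joinTop R S T T'
    have h1 : Continuous (rsFun R S) := continuous_coinduced_rng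
    have h2 : Continuous (fun p : ↥S =>
        (⟨(⟨(p.1.1, p.1.1), hER.refl _⟩, p), rfl⟩ : Fib R S)) :=
      Continuous.subtype_mk
        (((aux_cont_unit_s10 hER).comp (aux_cont_fst hES)).prodMk continuous_id) _
    exact h1.comp h2
  refine ⟨fun U hU => ⟨?_, ?_⟩, aux_restrict hR hRK hcR hP hsubR,
    aux_restrict hS hSK hcS hP hsubS⟩
  · obtain ⟨⟨hfin, hcl, hdisj, hun⟩, -, -, -, hcomp, -⟩ := hP
    refine aux_decomp (fun U hU => (hcl U hU).2.1) (fun U hU => (hcl U hU).1) hdisj hun hcomp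
      hRK hSK hKRS ?_ hsubR hsubS U hU
    intro x z y y' h1 h2 h3 h4
    exact hRS (y, y') ⟨hER.trans (hER.symm h1) h3, hES.trans h2 (hES.symm h4)⟩
  · obtain ⟨⟨hfin, hcl, hdisj, hun⟩, -, -, -, hcomp, -⟩ := hP
    refine aux_decomp (fun U hU => (hcl U hU).2.1) (fun U hU => (hcl U hU).1) hdisj hun hcomp
      hSK hRK (hKRS.trans hc1) ?_ hsubS hsubR U hU
    intro x z y y' h1 h2 h3 h4
    exact hRS (y, y') ⟨hER.trans h2 (hER.symm h4), hES.trans (hES.symm h1) h3⟩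
end
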